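/- arXiv:1610.01583 — 2 statements merged into one kernel-verified Lean document; each statement's English description precedes it below -/
import Mathlib

section
/- The function η_κ satisfies the same functional equation as the Dedekind zeta function: η_κ(1 − s) = |D_{κ/ℚ}|^{s − 1/2}·(cos(πs/2))^{r₁+r₂}·(sin(πs/2))^{r₂}·Γ_ℂ(s)^n·η_κ(s) as meromorphic functions on ℂ, where n = r₁ + 2r₂. -/
open Complex Filter Topology NumberField

/-- `f` has a zero of exact order `m` at `z`. -/
def ZeroOfOrder (f : ℂ → ℂ) (z : ℂ) (m : ℕ) : Prop :=
  ∃ g : ℂ → ℂ, AnalyticAt ℂ g z ∧ g z ≠ 0 ∧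
    ∀ᶠ w in 𝓝[≠] z, f w = (w - z) ^ m * g w

/-- `sν` enumerates, counted with multiplicity, the zeros of `f` with `Re = 1/2`, `Im > 0`. -/
def CriticalZeroEnumFor (f : ℂ → ℂ) (sν : ℕ → ℂ) : Prop :=
  (∀ ν, (sν ν).re = 1 / 2 ∧ 0 < (sν ν).im ∧ f (sν ν) = 0) ∧
  ∀ z : ℂ, z.re = 1 / 2 → 0 < z.im → f z = 0 →
    ZeroOfOrder f z (Nat.card {ν : ℕ // sν ν = z})

noncomputable def GammaR (s : ℂ) : ℂ := (Real.pi : ℂ) ^ (-s / 2) * Complex.Gamma (s / 2)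

noncomputable def GammaC (s : ℂ) : ℂ := 2 * (2 * (Real.pi : ℂ)) ^ (-s) * Complex.Gamma s

variable (K : Type) [Field K] [NumberField K]

/-- The constant `2^{r₁+r₂-1} c_κ R_κ / w_κ`. -/
noncomputable def dedekindConst : ℝ :=
  2 ^ ((InfinitePlace.nrRealPlaces K : ℤ) + InfinitePlace.nrComplexPlaces K - 1) *
    classNumber K * Units.regulator K / (Units.torsionOrder K : ℝ)

/-- `|D_{κ/ℚ}|` as a real number. -/
noncomputable def absDisc : ℝ := |(discr K : ℝ)|

/-- The residue `2^{r₁} (2π)^{r₂} c_κ R_κ / (w_κ √|D_κ|)` of `ζ_κ` at `s = 1`. -/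
noncomputable def dedekindResidue : ℝ :=
  2 ^ InfinitePlace.nrRealPlaces K * (2 * Real.pi) ^ InfinitePlace.nrComplexPlaces K *
    classNumber K * Units.regulator K /
    (Units.torsionOrder K * Real.sqrt (absDisc K))

/-- `ζK` agrees with the Dedekind zeta series `∑_𝔞 N(𝔞)^{-s}` on `Re s > 1`. -/
def IsDedekindSeries (zK : ℂ → ℂ) : Prop :=
  ∀ s : ℂ, 1 < s.re →
    zK s = ∑' I : {I : Ideal (RingOfIntegers K) // I ≠ ⊥},
      (Ideal.absNorm (I : Ideal (RingOfIntegers K)) : ℂ) ^ (-s)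

noncomputable def hKfun (sν : ℕ → ℂ) (s : ℂ) : ℂ :=
  (dedekindConst K : ℂ) * ∏' ν : ℕ, (1 - (s - s ^ 2) / ((‖sν ν‖ : ℂ) ^ 2))

noncomputable def etaKfun (sν : ℕ → ℂ) (s : ℂ) : ℂ :=
  hKfun K sν s /
    (s / 2 * (s - 1) * (absDisc K : ℂ) ^ (s / 2) *
      GammaR s ^ InfinitePlace.nrRealPlaces K * GammaC s ^ InfinitePlace.nrComplexPlaces K)


lemma absDisc_pos : 0 < absDisc K :=
  abs_pos.mpr (Int.cast_ne_zero.mpr (discr_ne_zero K))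

lemma hKfun_one_sub (sν : ℕ → ℂ) (s : ℂ) : hKfun K sν (1 - s) = hKfun K sν s := by
  unfold hKfun
  rw [show (1 - s) - (1 - s) ^ 2 = s - s ^ 2 by ring]

lemma GammaR_eq_zero_iff {s : ℂ} : GammaR s = 0 ↔ ∃ n : ℕ, s = -(2 * n) :=
  Gammaℝ_eq_zero_iff

lemma GammaR_one_sub_mul {s : ℂ} (hs : ∀ n : ℕ, s ≠ -n) (hs' : ∀ n : ℕ, s ≠ 1 + n) :
    GammaR (1 - s) * (GammaC s * cos (Real.pi * s / 2)) = GammaR s := by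
  have h₀ : GammaR (1 - s) ≠ 0 := by
    rw [Ne, GammaR_eq_zero_iff]
    rintro ⟨n, hn⟩
    exact hs' (2 * n) (by push_cast; linear_combination -hn)
  have h : GammaR s / GammaR (1 - s) = GammaC s * cos (Real.pi * s / 2) :=
    Gammaℝ_div_Gammaℝ_one_sub fun n hn ↦ hs (2 * n + 1) (by push_cast; exact hn)
  rw [← h, mul_div_cancel₀ _ h₀]

lemma GammaC_mul_GammaC_one_sub (s : ℂ) :
    GammaC s * GammaC (1 - s) = 2 / sin (Real.pi * s) := by
  have hπ : (Real.pi : ℂ) ≠ 0 := ofReal_ne_zero.mpr Real.pi_ne_zero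
  have hpow : (2 * (Real.pi : ℂ)) ^ (-s) * (2 * (Real.pi : ℂ)) ^ (-(1 - s)) =
      (2 * (Real.pi : ℂ))⁻¹ := by
    rw [← cpow_add _ _ (mul_ne_zero two_ne_zero hπ), ← cpow_neg_one]
    ring_nf
  calc GammaC s * GammaC (1 - s)
      = 4 * ((2 * (Real.pi : ℂ)) ^ (-s) * (2 * (Real.pi : ℂ)) ^ (-(1 - s))) *
          (Gamma s * Gamma (1 - s)) := by unfold GammaC; ring
    _ = 2 / sin (Real.pi * s) := by
        rw [hpow, Complex.Gamma_mul_Gamma_one_sub]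
        field_simp
        norm_num

lemma sin_pi_mul_ne_zero_of_ne_int {s : ℂ} (hs : ∀ n : ℕ, s ≠ -n) (hs' : ∀ n : ℕ, s ≠ 1 + n) :
    sin (Real.pi * s) ≠ 0 := by
  have h₁ := Complex.Gamma_ne_zero hs
  have h₂ : Gamma (1 - s) ≠ 0 :=
    Complex.Gamma_ne_zero fun n hn ↦ hs' n (by linear_combination -hn)
  intro h
  have := Complex.Gamma_mul_Gamma_one_sub s
  rw [h, div_zero] at this
  exact mul_ne_zero h₁ h₂ this

lemma GammaC_mul_GammaC_one_sub_mul_cos_mul_sin {s : ℂ}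
    (hs : ∀ n : ℕ, s ≠ -n) (hs' : ∀ n : ℕ, s ≠ 1 + n) :
    GammaC s * GammaC (1 - s) * cos (Real.pi * s / 2) * sin (Real.pi * s / 2) = 1 := by
  have hsin := sin_pi_mul_ne_zero_of_ne_int hs hs'
  have hdouble : sin (Real.pi * s) =
      2 * sin (Real.pi * s / 2) * cos (Real.pi * s / 2) := by
    rw [← Complex.sin_two_mul]
    ring_nf
  rw [mul_assoc, GammaC_mul_GammaC_one_sub, div_mul_eq_mul_div, div_eq_one_iff_eq hsin, hdouble]
  ring

/-- `η_κ` satisfies the same functional equation as `ζ_κ`: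
`η_κ(1-s) = |D|^{s-1/2} cos(πs/2)^{r₁+r₂} sin(πs/2)^{r₂} Γ_ℂ(s)^n η_κ(s)`
as meromorphic functions on `ℂ`. -/
theorem etaKfun_functional_equation (zK : ℂ → ℂ) (sν : ℕ → ℂ)
    (hser : IsDedekindSeries K zK)
    (hdiff : ∀ s : ℂ, s ≠ 1 → DifferentiableAt ℂ zK s)
    (henum : CriticalZeroEnumFor zK sν) :
    ∀ s : ℂ, (∀ n : ℕ, s ≠ -n) → (∀ n : ℕ, s ≠ 1 + n) →
      etaKfun K sν (1 - s) =
        (absDisc K : ℂ) ^ (s - 1 / 2) *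
          Complex.cos ((Real.pi : ℂ) * s / 2) ^
            (InfinitePlace.nrRealPlaces K + InfinitePlace.nrComplexPlaces K) *
          Complex.sin ((Real.pi : ℂ) * s / 2) ^ InfinitePlace.nrComplexPlaces K *
          GammaC s ^ (InfinitePlace.nrRealPlaces K + 2 * InfinitePlace.nrComplexPlaces K) *
          etaKfun K sν s := by
  intro s hs hs'
  have hΓR := GammaR_one_sub_mul hs hs'
  have hΓC := GammaC_mul_GammaC_one_sub_mul_cos_mul_sin hs hs'
  have hD : (absDisc K : ℂ) ≠ 0 := ofReal_ne_zero.mpr (absDisc_pos K).ne'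
  have hDpow : (absDisc K : ℂ) ^ ((1 - s) / 2) * (absDisc K : ℂ) ^ (s - 1 / 2) =
      (absDisc K : ℂ) ^ (s / 2) := by
    rw [← cpow_add _ _ hD]
    ring_nf
  have hP : (absDisc K : ℂ) ^ (s - 1 / 2) ≠ 0 := by simp [cpow_eq_zero_iff, hD]
  unfold etaKfun
  rw [hKfun_one_sub, ← hDpow, ← hΓR]
  generalize InfinitePlace.nrRealPlaces K = r₁
  generalize InfinitePlace.nrComplexPlaces K = r₂
  generalize (absDisc K : ℂ) ^ (s - 1 / 2) = P at hP ⊢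
  generalize (absDisc K : ℂ) ^ ((1 - s) / 2) = Q
  generalize GammaR (1 - s) = g
  generalize cos (Real.pi * s / 2) = c at hΓC ⊢
  generalize sin (Real.pi * s / 2) = d at hΓC ⊢
  generalize GammaC (1 - s) = C' at hΓC ⊢
  generalize GammaC s = C at hΓC ⊢
  generalize hKfun K sν s = h
  obtain rfl : C' = (C * c * d)⁻¹ := eq_inv_of_mul_eq_one_left (by linear_combination hΓC)
  have hC : C ≠ 0 := by rintro rfl; simp at hΓC
  have hc : c ≠ 0 := by rintro rfl; simp at hΓC
  rw [show (1 - s) / 2 * (1 - s - 1) = s / 2 * (s - 1) by ring]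
  generalize s / 2 * (s - 1) = A
  calc h / (A * Q * g ^ r₁ * (C * c * d)⁻¹ ^ r₂)
      = h * (C * c * d) ^ r₂ / (A * Q * g ^ r₁) := by
        rw [inv_pow, ← div_eq_mul_inv, div_div_eq_mul_div]
    _ = h * (C * c * d) ^ r₂ * (P * (C * c) ^ r₁ * C ^ r₂) /
          (A * Q * g ^ r₁ * (P * (C * c) ^ r₁ * C ^ r₂)) := by
        rw [mul_div_mul_right]
        positivity
    _ = _ := by
        rw [mul_div_assoc']
        congr 1 <;> ring
end

section
/- The function η_κ has a simple pole at s = 1 with lim_{s→1} (s − 1)η_κ(s) = 2^{r₁}(2π)^{r₂} c_κ R_κ / (w_κ·√|D_{κ/ℚ}|); in particular, by the analytic class number formula, η_κ and ζ_κ have the same residue at s = 1. -/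
open Complex Filter Topology NumberField

variable (K : Type) [Field K] [NumberField K]

section Blaschke

open scoped ComplexConjugate

/-- The Möbius factor of the right half-plane `0 < re` vanishing at `ρ`. -/
noncomputable def halfPlaneFactor (ρ s : ℂ) : ℂ := (s - ρ) / (s + conj ρ)

lemma add_conj_ne_zero {ρ s : ℂ} (hρ : 0 < ρ.re) (hs : 0 < s.re) : s + conj ρ ≠ 0 := by
  intro h
  have := congrArg Complex.re h
  simp at this
  linarith

lemma norm_halfPlaneFactor_sq {ρ s : ℂ} (hρ : 0 < ρ.re) (hs : 0 < s.re) :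
    ‖halfPlaneFactor ρ s‖ ^ 2 = 1 - 4 * s.re * ρ.re / ‖s + conj ρ‖ ^ 2 := by
  have h : ‖s + conj ρ‖ ^ 2 ≠ 0 := by
    simpa using add_conj_ne_zero hρ hs
  rw [halfPlaneFactor, norm_div, div_pow, eq_sub_iff_add_eq, ← add_div, div_eq_one_iff_eq h,
    ← Complex.normSq_eq_norm_sq, ← Complex.normSq_eq_norm_sq]
  simp only [Complex.normSq_apply, sub_re, sub_im, add_re, add_im, conj_re, conj_im]
  ring

/-- Schwarz lemma on the right half-plane: a zero can be divided out without increasing the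
sup norm. -/
lemma exists_eq_halfPlaneFactor_mul {f : ℂ → ℂ} {M : ℝ} {ρ : ℂ}
    (hf : DifferentiableOn ℂ f {s | 0 < s.re}) (hM : ∀ s, 0 < s.re → ‖f s‖ ≤ M)
    (hρ : 0 < ρ.re) (h0 : f ρ = 0) :
    ∃ g : ℂ → ℂ, DifferentiableOn ℂ g {s | 0 < s.re} ∧ (∀ s, 0 < s.re → ‖g s‖ ≤ M) ∧
      ∀ s, 0 < s.re → f s = halfPlaneFactor ρ s * g s := by
  let c : ℂ → ℂ := fun z => (ρ + z * conj ρ) / (1 - z)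
  have hne : ∀ z ∈ Metric.ball (0 : ℂ) 1, 1 - z ≠ 0 := by
    intro z hz h
    rw [sub_eq_zero] at h
    simp [← h] at hz
  have hc : ∀ z ∈ Metric.ball (0 : ℂ) 1, 0 < (c z).re := by
    intro z hz
    have h1 : 0 < Complex.normSq (1 - z) := Complex.normSq_pos.2 (hne z hz)
    have h2 : (c z).re = ρ.re * (1 - Complex.normSq z) / Complex.normSq (1 - z) := by
      simp only [c, Complex.div_re, Complex.normSq_apply, sub_re, sub_im, add_re, add_im, mul_re,
        mul_im, conj_re, conj_im, one_re, one_im]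
      rw [← add_div]
      ring
    have h3 : Complex.normSq z < 1 := by
      rw [Complex.normSq_eq_norm_sq]
      have : ‖z‖ < 1 := by simpa using hz
      nlinarith [norm_nonneg z]
    rw [h2]
    exact div_pos (mul_pos hρ (by linarith)) h1
  have hcd : DifferentiableOn ℂ c (Metric.ball 0 1) := by
    intro z hz
    have := hne z hz
    refine DifferentiableAt.differentiableWithinAt ?_
    fun_prop (disch := assumption)
  have hk0 : f (c 0) = 0 := by simp [c, h0]
  have hkd : DifferentiableOn ℂ (f ∘ c) (Metric.ball 0 1) := hf.comp hcd hc
  have hkm : Set.MapsTo (f ∘ c) (Metric.ball 0 1) (Metric.closedBall ((f ∘ c) 0) M) := by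
    intro z hz
    simpa [hk0] using hM _ (hc z hz)
  have hψ : ∀ s : ℂ, 0 < s.re → halfPlaneFactor ρ s ∈ Metric.ball (0 : ℂ) 1 := by
    intro s hs
    have h := norm_halfPlaneFactor_sq hρ hs
    have h' : 0 < ‖s + conj ρ‖ ^ 2 := by
      have := add_conj_ne_zero hρ hs
      positivity
    have h'' : 0 < 4 * s.re * ρ.re / ‖s + conj ρ‖ ^ 2 := by positivity
    rw [mem_ball_zero_iff]
    nlinarith [norm_nonneg (halfPlaneFactor ρ s)]
  have hψd : DifferentiableOn ℂ (halfPlaneFactor ρ) {s | 0 < s.re} := by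
    intro s hs
    have := add_conj_ne_zero hρ hs
    unfold halfPlaneFactor
    refine DifferentiableAt.differentiableWithinAt ?_
    fun_prop (disch := assumption)
  have hcψ : ∀ s : ℂ, 0 < s.re → c (halfPlaneFactor ρ s) = s := by
    intro s hs
    have h1 := add_conj_ne_zero hρ hs
    have h2 := add_conj_ne_zero hρ hρ
    have h3 := hne _ (hψ s hs)
    simp only [c]
    rw [div_eq_iff h3]
    unfold halfPlaneFactor
    field_simp
    ring
  have hd : DifferentiableOn ℂ (dslope (f ∘ c) 0) (Metric.ball 0 1) :=
    (Complex.differentiableOn_dslope (Metric.ball_mem_nhds _ one_pos)).2 hkd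
  refine ⟨fun s => dslope (f ∘ c) 0 (halfPlaneFactor ρ s), hd.comp hψd hψ, ?_, ?_⟩
  · intro s hs
    simpa using Complex.norm_dslope_le_div_of_mapsTo_ball hkd hkm (hψ s hs)
  · intro s hs
    have := sub_smul_dslope (f ∘ c) 0 (halfPlaneFactor ρ s)
    simp only [sub_zero, Function.comp_apply, hk0, smul_eq_mul] at this
    rw [this, hcψ s hs]

lemma norm_le_mul_prod_halfPlaneFactor {ι : Type*} (ρ : ι → ℂ) {M : ℝ} (S : Finset ι)
    (hρ : ∀ i ∈ S, 0 < (ρ i).re) (f : ℂ → ℂ)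
    (hf : DifferentiableOn ℂ f {s | 0 < s.re}) (hM : ∀ s, 0 < s.re → ‖f s‖ ≤ M)
    (hord : ∀ z : ℂ, 0 < z.re → ∀ T ⊆ S, (∀ i ∈ T, ρ i = z) →
      (T.card : ℕ∞) ≤ analyticOrderAt f z) {s : ℂ} (hs : 0 < s.re) :
    ‖f s‖ ≤ M * ∏ i ∈ S, ‖halfPlaneFactor (ρ i) s‖ := by
  classical
  have hopen : IsOpen {s : ℂ | 0 < s.re} := isOpen_lt continuous_const Complex.continuous_re
  induction S using Finset.induction_on generalizing f with
  | empty => simpa using hM s hs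
  | insert a S ha ih =>
    have hρa := hρ a (Finset.mem_insert_self _ _)
    have han : ∀ h : ℂ → ℂ, DifferentiableOn ℂ h {s | 0 < s.re} → ∀ z : ℂ, 0 < z.re →
        AnalyticAt ℂ h z := fun h hh z hz => hh.analyticAt (hopen.mem_nhds hz)
    have h0 : f (ρ a) = 0 := by
      have := hord (ρ a) hρa {a} (by simp) (by simp)
      refine apply_eq_zero_of_analyticOrderAt_ne_zero (fun h => ?_)
      rw [h] at this
      simp at this
    obtain ⟨g, hg, hgM, hfg⟩ := exists_eq_halfPlaneFactor_mul hf hM hρa h0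
    have hordfg : ∀ z : ℂ, 0 < z.re →
        analyticOrderAt f z = analyticOrderAt (fun s => s - ρ a) z + analyticOrderAt g z := by
      intro z hz
      have hi : AnalyticAt ℂ (fun s : ℂ => (s + conj (ρ a))⁻¹) z :=
        AnalyticAt.fun_inv (by fun_prop) (add_conj_ne_zero hρa hz)
      have h1 : f =ᶠ[𝓝 z] ((fun s => s - ρ a) * (fun s => (s + conj (ρ a))⁻¹)) * g := by
        filter_upwards [hopen.mem_nhds hz] with w hw
        rw [hfg w hw, halfPlaneFactor, div_eq_mul_inv]
        rfl
      have hl : AnalyticAt ℂ (fun s : ℂ => s - ρ a) z := by fun_prop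
      rw [analyticOrderAt_congr h1, analyticOrderAt_mul (hl.mul hi) (han g hg z hz),
        analyticOrderAt_mul hl hi,
        hi.analyticOrderAt_eq_zero.2 (inv_ne_zero (add_conj_ne_zero hρa hz)), add_zero]
    rw [Finset.prod_insert ha, hfg s hs, norm_mul]
    have := ih (fun i hi => hρ i (Finset.mem_insert_of_mem hi)) g hg hgM (by
      intro z hz T hT hTz
      by_cases hza : ρ a = z
      · have haT : a ∉ T := fun h => ha (hT h)
        have h1 := hord z hz (insert a T) (Finset.insert_subset_insert _ hT) (by
          intro i hi
          rcases Finset.mem_insert.1 hi with rfl | hi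
          · exact hza
          · exact hTz i hi)
        rw [hordfg z hz, ← hza, Finset.card_insert_of_notMem haT] at h1
        have h2 : analyticOrderAt (fun s => s - ρ a) (ρ a) = 1 := analyticOrderAt_id_sub_const_self
        rw [h2, Nat.cast_add, Nat.cast_one, add_comm] at h1
        rw [← hza]
        exact (ENat.add_le_add_iff_left (by simp)).1 h1
      · have h1 := hord z hz T (hT.trans (Finset.subset_insert _ _)) hTz
        rw [hordfg z hz] at h1
        have h2 : analyticOrderAt (fun s => s - ρ a) z = 0 :=
          analyticOrderAt_eq_zero.2 (Or.inr (sub_ne_zero.2 (Ne.symm hza)))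
        rwa [h2, zero_add] at h1)
    calc ‖halfPlaneFactor (ρ a) s‖ * ‖g s‖
        ≤ ‖halfPlaneFactor (ρ a) s‖ * (M * ∏ i ∈ S, ‖halfPlaneFactor (ρ i) s‖) := by gcongr
      _ = _ := by ring

/-- The Blaschke condition for the zeros of a bounded holomorphic function on the right
half-plane. -/
lemma summable_blaschke {ι : Type*} (ρ : ι → ℂ) {M : ℝ} (hρ : ∀ i, 0 < (ρ i).re) {f : ℂ → ℂ}
    (hf : DifferentiableOn ℂ f {s | 0 < s.re}) (hM : ∀ s, 0 < s.re → ‖f s‖ ≤ M)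
    (hord : ∀ z : ℂ, 0 < z.re → ∀ T : Finset ι, (∀ i ∈ T, ρ i = z) →
      (T.card : ℕ∞) ≤ analyticOrderAt f z) {s : ℂ} (hs : 0 < s.re) (hfs : f s ≠ 0) :
    Summable (fun i => 4 * s.re * (ρ i).re / ‖s + conj (ρ i)‖ ^ 2) := by
  have hM0 : 0 < M := (norm_pos_iff.2 hfs).trans_le (hM s hs)
  have hδ : 0 < (‖f s‖ / M) ^ 2 := by positivity
  refine summable_of_sum_le (c := -Real.log ((‖f s‖ / M) ^ 2)) (fun i => ?_) (fun S => ?_)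
  · have := (hρ i).le
    have := hs.le
    positivity
  have h1 := norm_le_mul_prod_halfPlaneFactor ρ S (fun i _ => hρ i) f hf hM
    (fun z hz T _ hT => hord z hz T hT) hs
  have h2 : (‖f s‖ / M) ^ 2 ≤ ∏ i ∈ S, ‖halfPlaneFactor (ρ i) s‖ ^ 2 := by
    rw [Finset.prod_pow]
    gcongr
    rw [div_le_iff₀ hM0]
    linarith
  have h3 : ∏ i ∈ S, ‖halfPlaneFactor (ρ i) s‖ ^ 2
      ≤ ∏ i ∈ S, Real.exp (-(4 * s.re * (ρ i).re / ‖s + conj (ρ i)‖ ^ 2)) := by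
    refine Finset.prod_le_prod (fun i _ => by positivity) (fun i _ => ?_)
    rw [norm_halfPlaneFactor_sq (hρ i) hs]
    have := Real.add_one_le_exp (-(4 * s.re * (ρ i).re / ‖s + conj (ρ i)‖ ^ 2))
    linarith
  rw [← Real.exp_sum, Finset.sum_neg_distrib] at h3
  have h4 := Real.log_le_log hδ (h2.trans h3)
  rw [Real.log_exp] at h4
  linarith

end Blaschke

lemma norm_tprod_one_add_sub_one_le {ι : Type*} {a : ι → ℂ} (ha : Summable fun i => ‖a i‖) :
    ‖∏' i, (1 + a i) - 1‖ ≤ Real.exp (∑' i, ‖a i‖) - 1 := by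
  have hm : Multipliable fun i => 1 + a i := multipliable_one_add_of_summable ha
  refine le_of_tendsto ((hm.hasProd.sub_const 1).norm) (Eventually.of_forall fun S => ?_)
  refine (Finset.norm_prod_one_add_sub_one_le S a).trans ?_
  gcongr
  exact ha.sum_le_tsum S (fun i _ => norm_nonneg _)

lemma tendsto_tprod_one_sub_mul {ι : Type*} {c : ι → ℂ} (hc : Summable fun i => ‖c i‖) :
    Tendsto (fun s : ℂ => ∏' i, (1 - (s - s ^ 2) * c i)) (𝓝 1) (𝓝 1) := by
  rw [tendsto_iff_norm_sub_tendsto_zero]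
  have hlim : Tendsto (fun s : ℂ => Real.exp (‖s - s ^ 2‖ * ∑' i, ‖c i‖) - 1) (𝓝 1) (𝓝 0) := by
    have : Continuous (fun s : ℂ => Real.exp (‖s - s ^ 2‖ * ∑' i, ‖c i‖) - 1) := by fun_prop
    simpa using this.tendsto 1
  refine squeeze_zero (fun _ => norm_nonneg _) (fun s => ?_) hlim
  have h : (fun i => ‖-((s - s ^ 2) * c i)‖) = fun i => ‖s - s ^ 2‖ * ‖c i‖ := by
    ext i; rw [norm_neg, norm_mul]
  have := norm_tprod_one_add_sub_one_le (a := fun i => -((s - s ^ 2) * c i)) (by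
    rw [h]; exact hc.mul_left _)
  rw [h, tsum_mul_left] at this
  simpa only [← sub_eq_add_neg] using this

lemma GammaR_one : GammaR 1 = 1 := by
  rw [GammaR, Complex.Gamma_one_half_eq, ← Complex.cpow_add _ _ (by simp [Real.pi_ne_zero])]
  norm_num

lemma GammaC_one : GammaC 1 = (Real.pi : ℂ)⁻¹ := by
  rw [GammaC, Complex.Gamma_one, Complex.cpow_neg_one]
  have : (Real.pi : ℂ) ≠ 0 := by simp [Real.pi_ne_zero]
  field_simp

/-- If the product converges, the residue of `η_κ` at `1` is the one of `ζ_κ`. -/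
lemma tendsto_sub_one_mul_etaKfun {sν : ℕ → ℂ} (hs : Summable fun ν => (‖sν ν‖ ^ 2)⁻¹) :
    Tendsto (fun s : ℂ => (s - 1) * etaKfun K sν s) (𝓝[≠] 1)
      (𝓝 (dedekindResidue K : ℂ)) := by
  have hD : (absDisc K : ℂ) ≠ 0 := by exact_mod_cast (absDisc_pos K).ne'
  have hpi : (Real.pi : ℂ) ≠ 0 := by simp [Real.pi_ne_zero]
  have hR : ContinuousAt GammaR 1 := by
    unfold GammaR
    refine ContinuousAt.mul ?_ ?_
    · exact ContinuousAt.const_cpow (by fun_prop) (Or.inl hpi)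
    · refine ContinuousAt.comp (f := fun s : ℂ => s / 2) (g := Complex.Gamma) ?_ (by fun_prop)
      refine (Complex.differentiableAt_Gamma _ fun m h => ?_).continuousAt
      have := congrArg Complex.re h
      simp at this
      linarith [(Nat.cast_nonneg m : (0 : ℝ) ≤ m)]
  have hC : ContinuousAt GammaC 1 := by
    unfold GammaC
    refine ContinuousAt.mul (continuousAt_const.mul ?_) ?_
    · exact ContinuousAt.const_cpow (by fun_prop) (Or.inl (by simp))
    · refine (Complex.differentiableAt_Gamma _ fun m h => ?_).continuousAt
      have := congrArg Complex.re h
      simp at this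
      linarith [(Nat.cast_nonneg m : (0 : ℝ) ≤ m)]
  have hA : ContinuousAt (fun s : ℂ => s / 2 * (absDisc K : ℂ) ^ (s / 2) *
      GammaR s ^ InfinitePlace.nrRealPlaces K * GammaC s ^ InfinitePlace.nrComplexPlaces K) 1 := by
    refine ((ContinuousAt.mul (by fun_prop) ?_).mul (hR.pow _)).mul (hC.pow _)
    exact ContinuousAt.const_cpow (by fun_prop) (Or.inl hD)
  have hsqrt : (absDisc K : ℂ) ^ (1 / 2 : ℂ) = (Real.sqrt (absDisc K) : ℂ) := by
    rw [Real.sqrt_eq_rpow, Complex.ofReal_cpow (absDisc_pos K).le]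
    norm_num
  have hsq : (Real.sqrt (absDisc K) : ℂ) ≠ 0 := by
    exact_mod_cast (Real.sqrt_pos.2 (absDisc_pos K)).ne'
  have hP := tendsto_tprod_one_sub_mul (c := fun ν => ((‖sν ν‖ : ℂ) ^ 2)⁻¹) (by simpa using hs)
  have hlim := (hP.const_mul (dedekindConst K : ℂ)).div hA.tendsto (by
    rw [GammaR_one, GammaC_one, hsqrt]
    simp [hsq, hpi])
  rw [GammaR_one, GammaC_one, hsqrt] at hlim
  have hval : (dedekindConst K : ℂ) * 1 / (1 / 2 * (Real.sqrt (absDisc K) : ℂ) *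
      1 ^ InfinitePlace.nrRealPlaces K * (Real.pi : ℂ)⁻¹ ^ InfinitePlace.nrComplexPlaces K) =
      (dedekindResidue K : ℂ) := by
    have hw : (Units.torsionOrder K : ℂ) ≠ 0 := by
      exact_mod_cast Units.torsionOrder_ne_zero K
    rw [dedekindConst, dedekindResidue, zpow_sub₀ two_ne_zero, zpow_add₀ two_ne_zero]
    push_cast
    simp only [zpow_natCast, zpow_one, one_pow, mul_one, inv_pow, mul_pow]
    field_simp
  rw [hval] at hlim
  refine (hlim.mono_left nhdsWithin_le_nhds).congr' ?_
  filter_upwards [self_mem_nhdsWithin] with s hs1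
  have hs1 : s - 1 ≠ 0 := sub_ne_zero.2 hs1
  simp only [etaKfun, hKfun, Pi.div_apply, ← div_eq_mul_inv]
  rw [← mul_div_assoc, mul_comm (s - 1), show s / 2 * (s - 1) * (absDisc K : ℂ) ^ (s / 2) *
      GammaR s ^ InfinitePlace.nrRealPlaces K * GammaC s ^ InfinitePlace.nrComplexPlaces K =
      s / 2 * (absDisc K : ℂ) ^ (s / 2) *
      GammaR s ^ InfinitePlace.nrRealPlaces K * GammaC s ^ InfinitePlace.nrComplexPlaces K *
      (s - 1) by ring, mul_div_mul_right _ _ hs1]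

open MeasureTheory

section Poisson

variable {ι : Type*} [Fintype ι]

lemma locallyFinite_support_comp_add_int {E : Type*} [Zero E] {f : (ι → ℝ) → E}
    {R : ℝ} (hR : ∀ x, f x ≠ 0 → ‖x‖ ≤ R) :
    LocallyFinite fun m : ι → ℤ =>
      Function.support fun x : ι → ℝ => f (x + fun i => (m i : ℝ)) := by
  classical
  intro x
  refine ⟨Metric.ball x 1, Metric.ball_mem_nhds x one_pos, ?_⟩
  obtain ⟨N, hN⟩ := exists_nat_ge (R + ‖x‖ + 1)
  refine (Set.finite_Icc (fun _ : ι => -(N : ℤ)) fun _ => (N : ℤ)).subset ?_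
  rintro m ⟨y, hy, hyx⟩
  have h1 : ‖y + fun i => (m i : ℝ)‖ ≤ R := hR _ hy
  have h2 : ‖y‖ ≤ ‖x‖ + 1 := by
    have h3 : ‖y - x‖ < 1 := by simpa [dist_eq_norm] using hyx
    linarith [norm_sub_norm_le y x]
  have h3 (i : ι) : |(m i : ℝ)| ≤ N := by
    have := norm_le_pi_norm (y + fun i => (m i : ℝ)) i
    have h4 := norm_le_pi_norm y i
    simp only [Pi.add_apply, Real.norm_eq_abs] at this h4
    have h5 := abs_sub_abs_le_abs_sub (m i : ℝ) (-(y i))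
    rw [abs_neg, sub_neg_eq_add, add_comm (m i : ℝ)] at h5
    linarith
  refine ⟨fun i => ?_, fun i => ?_⟩
  · exact_mod_cast (abs_le.1 (h3 i)).1
  · exact_mod_cast (abs_le.1 (h3 i)).2

lemma setIntegral_cube_finsum_comp_add_int {h : (ι → ℝ) → ℂ} (hc : Continuous h)
    {R : ℝ} (hR : ∀ x, h x ≠ 0 → ‖x‖ ≤ R) :
    ∫ x in {x : ι → ℝ | ∀ i, x i ∈ Set.Ioc (0 : ℝ) (0 + 1)},
      ∑ᶠ m : ι → ℤ, h (x + fun i => (m i : ℝ)) = ∫ x, h x := by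
  classical
  have hint : Integrable h := hc.integrable_of_hasCompactSupport <|
    HasCompactSupport.of_support_subset_isCompact (isCompact_closedBall (0 : ι → ℝ) R)
      fun x hx => by simpa using hR x hx
  set s : (ι → ℤ) → Set (ι → ℝ) := fun m => {x | ∀ i, x i ∈ Set.Ioc (m i : ℝ) (m i + 1)} with hs
  have hmeas (m) : MeasurableSet (s m) := by
    have : s m = Set.univ.pi fun i => Set.Ioc (m i : ℝ) (m i + 1) := by ext; simp [hs]
    rw [this]
    exact MeasurableSet.univ_pi fun i => measurableSet_Ioc
  have hceil {m : ι → ℤ} {x} (hx : x ∈ s m) (i) : m i = ⌈x i⌉ - 1 := by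
    have : ⌈x i⌉ = m i + 1 := Int.ceil_eq_iff.2
      ⟨by push_cast; linarith [(hx i).1], by push_cast; exact (hx i).2⟩
    omega
  have hdisj : Pairwise (Function.onFun Disjoint s) := fun m m' hmm =>
    Set.disjoint_left.2 fun x hx hx' => hmm <| funext fun i => by rw [hceil hx, hceil hx']
  have hunion : ⋃ m, s m = Set.univ := by
    refine Set.eq_univ_of_forall fun x => Set.mem_iUnion.2 ⟨fun i => ⌈x i⌉ - 1, fun i => ?_⟩
    push_cast
    exact ⟨by linarith [Int.ceil_lt_add_one (x i)], by linarith [Int.le_ceil (x i)]⟩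
  have hsum := hasSum_integral_iUnion (μ := volume) (f := h) hmeas hdisj hint.integrableOn
  rw [hunion, setIntegral_univ] at hsum
  have hs0 : {x : ι → ℝ | ∀ i, x i ∈ Set.Ioc (0 : ℝ) (0 + 1)} = s 0 := by ext; simp [hs]
  have htrans (m : ι → ℤ) : ∫ x in s m, h x = ∫ x in s 0, h (x + fun i => (m i : ℝ)) := by
    rw [← (measurePreserving_add_right volume (fun i => (m i : ℝ))).setIntegral_preimage_emb
      (measurableEmbedding_addRight _) h (s m)]
    congr 2
    ext x
    refine forall_congr' fun i => ?_
    simp [add_comm (x i)]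
  obtain ⟨N, hN⟩ := exists_nat_ge (R + 1)
  set T : Finset (ι → ℤ) := Finset.Icc (fun _ : ι => -(N : ℤ)) fun _ => (N : ℤ)
  have hT (m) (hm : m ∉ T) (x) (hx : x ∈ s 0) : h (x + fun i => (m i : ℝ)) = 0 := by
    by_contra hne
    have h1 := hR _ hne
    have h3 (i : ι) : |(m i : ℝ)| ≤ N := by
      have h2 := norm_le_pi_norm (x + fun i => (m i : ℝ)) i
      have h4 : |x i| ≤ 1 := by
        have := hx i
        simp at this
        exact abs_le.2 ⟨by linarith, by linarith⟩
      simp only [Pi.add_apply, Real.norm_eq_abs] at h2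
      have h5 := abs_sub_abs_le_abs_sub (m i : ℝ) (-(x i))
      rw [abs_neg, sub_neg_eq_add, add_comm (m i : ℝ)] at h5
      linarith
    refine hm (Finset.mem_Icc.2 ⟨fun i => ?_, fun i => ?_⟩)
    · exact_mod_cast (abs_le.1 (h3 i)).1
    · exact_mod_cast (abs_le.1 (h3 i)).2
  have hfin : HasSum (fun m => ∫ x in s m, h x) (∑ m ∈ T, ∫ x in s m, h x) :=
    hasSum_sum_of_ne_finset_zero fun m hm => by
      rw [htrans]
      exact setIntegral_eq_zero_of_forall_eq_zero (hT m hm)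
  rw [hs0, ← hfin.unique hsum]
  simp_rw [htrans]
  rw [← integral_finsetSum _ fun m _ => (hint.comp_add_right _).integrableOn]
  refine setIntegral_congr_fun (hmeas 0) fun x hx => ?_
  exact finsum_eq_sum_of_support_subset _ fun m hm => by
    by_contra hmT
    exact hm (hT m (by simpa using hmT) x hx)

/-- Poisson summation for continuous compactly supported functions on `ℝ^ι` whose Fourier
transform is summable over the integer points. -/
theorem hasSum_fourierIntegral_int {f : (ι → ℝ) → ℂ} (hc : Continuous f)
    {R : ℝ} (hR : ∀ x, f x ≠ 0 → ‖x‖ ≤ R)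
    (hsum : Summable fun k : ι → ℤ =>
      ∫ x, UnitAddTorus.mFourier (-k) (fun i => (x i : UnitAddCircle)) • f x) :
    HasSum (fun k : ι → ℤ =>
      ∫ x, UnitAddTorus.mFourier (-k) (fun i => (x i : UnitAddCircle)) • f x)
      (∑ᶠ m : ι → ℤ, f fun i => (m i : ℝ)) := by
  classical
  let π : C(ι → ℝ, UnitAddTorus ι) := ⟨fun x i => (x i : UnitAddCircle), by
    refine continuous_pi fun i => ?_
    exact (AddCircle.continuous_mk' 1).comp (continuous_apply i)⟩
  have hπ : IsQuotientMap π := by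
    have : IsOpenQuotientMap (Pi.map fun (_ : ι) (x : ℝ) => (x : UnitAddCircle)) :=
      IsOpenQuotientMap.piMap fun _ => QuotientAddGroup.isOpenQuotientMap_mk
    exact this.isQuotientMap
  let P : C(ι → ℝ, ℂ) := ⟨fun x => ∑ᶠ m : ι → ℤ, f (x + fun i => (m i : ℝ)),
    continuous_finsum (fun m => hc.comp (continuous_add_const _))
      (locallyFinite_support_comp_add_int hR)⟩
  have hP (x y) (hxy : π x = π y) : P x = P y := by
    have hm (i : ι) : ∃ m : ℤ, (m : ℝ) = y i - x i := by
      have h1 : (x i : UnitAddCircle) = (y i : UnitAddCircle) := congrFun hxy i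
      obtain ⟨m, hm⟩ := AddSubgroup.mem_zmultiples_iff.1 (QuotientAddGroup.eq.1 h1)
      exact ⟨m, by simp at hm; linarith⟩
    choose m hm using hm
    change ∑ᶠ k : ι → ℤ, f (x + fun i => (k i : ℝ)) = ∑ᶠ k : ι → ℤ, f (y + fun i => (k i : ℝ))
    rw [← finsum_comp_equiv (Equiv.addLeft m)]
    refine finsum_congr fun k => congrArg f <| funext fun i => ?_
    simp only [Pi.add_apply, Equiv.coe_addLeft, Int.cast_add, hm]
    ring
  let Q : C(UnitAddTorus ι, ℂ) := hπ.lift P hP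
  have hQ (x) : Q (π x) = P x := DFunLike.congr_fun (hπ.lift_comp P hP) x
  have hcoeff (k : ι → ℤ) : UnitAddTorus.mFourierCoeff Q k =
      ∫ x, UnitAddTorus.mFourier (-k) (fun i => (x i : UnitAddCircle)) • f x := by
    rw [UnitAddTorus.mFourierCoeff_eq_integral _ _ 0,
      ← setIntegral_cube_finsum_comp_add_int
        (h := fun x => UnitAddTorus.mFourier (-k) (fun i => (x i : UnitAddCircle)) • f x)
        (R := R) (((UnitAddTorus.mFourier (-k)).continuous.comp π.continuous).smul hc)
        fun x hx => hR x (right_ne_zero_of_smul hx)]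
    refine integral_congr_ae (ae_of_all _ fun x => ?_)
    have h1 : Q (fun i => (x i : UnitAddCircle)) =
        ∑ᶠ m : ι → ℤ, f (x + fun i => (m i : ℝ)) := hQ x
    simp only [h1, smul_eq_mul]
    rw [mul_finsum]
    refine finsum_congr fun m => ?_
    congr 2
    funext i
    simp
  have := UnitAddTorus.hasSum_mFourier_series_apply_of_summable (f := Q)
    (by simpa only [funext hcoeff] using hsum) 0
  have h0 : Q 0 = ∑ᶠ m : ι → ℤ, f fun i => (m i : ℝ) := by
    have := hQ 0
    have hz : π 0 = 0 := by ext i; simp [π]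
    rw [hz] at this
    rw [this]
    change ∑ᶠ m : ι → ℤ, f (0 + fun i => (m i : ℝ)) = _
    simp
  have h1 (k : ι → ℤ) : UnitAddTorus.mFourier k (0 : UnitAddTorus ι) = 1 := by
    simp [UnitAddTorus.mFourier]
  simpa only [h0, h1, smul_eq_mul, mul_one, hcoeff] using this

end Poisson

section Scaling

open scoped FourierTransform SchwartzMap

variable {ι : Type*} [Fintype ι]

lemma intCast_mem_span_basisFun (k : ι → ℤ) :
    (fun i => (k i : ℝ)) ∈ Submodule.span ℤ (Set.range (Pi.basisFun ℝ ι)) :=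
  ((Pi.basisFun ℝ ι).mem_span_iff_repr_mem ℤ _).2 fun i => ⟨k i, by simp⟩

lemma summable_norm_intCast_inv_pow {r : ℕ} (hr : Fintype.card ι < r) :
    Summable fun k : ι → ℤ => ‖(fun i => (k i : ℝ) : ι → ℝ)‖⁻¹ ^ r := by
  have hL : Module.finrank ℤ (Submodule.span ℤ (Set.range (Pi.basisFun ℝ ι))) < r := by
    rwa [finrank_span_eq_card ((Pi.basisFun ℝ ι).linearIndependent.restrict_scalars' ℤ)]
  have h := ZLattice.summable_norm_pow_inv
    (L := Submodule.span ℤ (Set.range (Pi.basisFun ℝ ι))) r hL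
  have hi : Function.Injective fun k : ι → ℤ => (⟨fun i => (k i : ℝ),
      intCast_mem_span_basisFun k⟩ : Submodule.span ℤ (Set.range (Pi.basisFun ℝ ι))) := by
    intro k l hkl
    have h1 : (fun i => (k i : ℝ)) = fun i => (l i : ℝ) := congrArg Subtype.val hkl
    exact funext fun i => by simpa using congrFun h1 i
  exact (h.comp_injective hi).congr fun k => rfl

lemma integral_mFourier_smul_comp_smul (f : EuclideanSpace ℝ ι → ℂ) {t : ℝ} (ht : 0 < t)
    (k : ι → ℤ) :
    ∫ x : ι → ℝ, UnitAddTorus.mFourier (-k) (fun i => (x i : UnitAddCircle)) •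
        f (t • WithLp.toLp 2 x) =
      (t ^ Fintype.card ι)⁻¹ • 𝓕 f (t⁻¹ • WithLp.toLp 2 fun i => (k i : ℝ)) := by
  have h1 := Measure.integral_comp_smul_of_nonneg (μ := (volume : Measure (EuclideanSpace ℝ ι)))
    (fun v => Complex.exp (((-2 * Real.pi *
      inner ℝ v (t⁻¹ • WithLp.toLp 2 fun i => (k i : ℝ)) : ℝ) : ℂ) * Complex.I) • f v)
    t (hR := ht.le)
  rw [finrank_euclideanSpace] at h1
  rw [Real.fourier_eq', ← h1, ← (PiLp.volume_preserving_toLp ι).integral_comp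
    (MeasurableEquiv.toLp 2 _).measurableEmbedding]
  refine integral_congr_ae (ae_of_all _ fun x => ?_)
  simp only
  congr 1
  rw [real_inner_smul_left, real_inner_smul_right, mul_inv_cancel_left₀ ht.ne',
    PiLp.inner_apply]
  simp only [UnitAddTorus.mFourier, ContinuousMap.coe_mk, Pi.neg_apply, fourier_coe_apply,
    ← Complex.exp_sum]
  congr 1
  simp only [Finset.mul_sum, RCLike.inner_apply, conj_trivial]
  push_cast
  simp only [Finset.sum_mul]
  refine Finset.sum_congr rfl fun i _ => ?_
  ring

/-- The sum of a smooth compactly supported function over a scaled cubic lattice is its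
integral divided by the covolume, up to an error that tends to zero. -/
theorem exists_norm_finsum_smul_sub_le {f : EuclideanSpace ℝ ι → ℂ} (hf : ContDiff ℝ (⊤ : ℕ∞) f)
    (hs : HasCompactSupport f) :
    ∃ (c : ℂ) (C : ℝ), ∀ t : ℝ, 0 < t →
      ‖(∑ᶠ m : ι → ℤ, f (t • WithLp.toLp 2 fun i => (m i : ℝ))) - c / (t : ℂ) ^ Fintype.card ι‖
        ≤ C * t := by
  classical
  obtain ⟨C, hC0, hC⟩ := (𝓕 (hs.toSchwartzMap hf)).decay (Fintype.card ι + 1) 0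
  have hC' (x) : ‖x‖ ^ (Fintype.card ι + 1) * ‖𝓕 f x‖ ≤ C := by
    have := hC x
    rwa [norm_iteratedFDeriv_zero, SchwartzMap.fourier_coe] at this
  set S : (ι → ℤ) → ℝ := fun k => ‖(fun i => (k i : ℝ) : ι → ℝ)‖⁻¹ ^ (Fintype.card ι + 1) with hS
  have hSsum : Summable S := summable_norm_intCast_inv_pow (Nat.lt_succ_self _)
  refine ⟨𝓕 f 0, C * ∑' k, S k, fun t ht => ?_⟩
  have hle (x : ι → ℝ) : ‖x‖ ≤ ‖WithLp.toLp 2 x‖ :=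
    (pi_norm_le_iff_of_nonneg (norm_nonneg _)).2 fun i =>
      PiLp.norm_apply_le (WithLp.toLp 2 x) i
  obtain ⟨R, hR⟩ := hs.isCompact.isBounded.exists_norm_le
  set a : (ι → ℤ) → ℂ := fun k =>
    (t ^ Fintype.card ι)⁻¹ • 𝓕 f (t⁻¹ • WithLp.toLp 2 fun i => (k i : ℝ)) with ha
  have hbound (k : ι → ℤ) (hk : k ≠ 0) : ‖a k‖ ≤ C * t * S k := by
    have hk' : 0 < ‖(fun i => (k i : ℝ) : ι → ℝ)‖ := by
      refine norm_pos_iff.2 fun h => hk (funext fun i => ?_)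
      simpa using congrFun h i
    have h1 := hle fun i => (k i : ℝ)
    have h2 := hC' (t⁻¹ • WithLp.toLp 2 fun i => (k i : ℝ))
    rw [norm_smul, norm_inv, Real.norm_eq_abs, abs_of_pos ht, inv_mul_eq_div, div_pow,
      div_mul_eq_mul_div, div_le_iff₀ (by positivity)] at h2
    simp only [ha, hS]
    rw [norm_smul, norm_inv, norm_pow, Real.norm_eq_abs, abs_of_pos ht, inv_pow,
      inv_mul_eq_div, ← div_eq_mul_inv, div_le_div_iff₀ (by positivity) (by positivity)]
    calc _ ≤ ‖𝓕 f (t⁻¹ • WithLp.toLp 2 fun i => (k i : ℝ))‖ *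
          ‖WithLp.toLp 2 fun i => (k i : ℝ)‖ ^ (Fintype.card ι + 1) := by gcongr
      _ ≤ _ := by rw [mul_comm]; refine h2.trans_eq ?_; ring
  have hb (k : ι → ℤ) : ‖a k - if k = 0 then a 0 else 0‖ ≤ C * t * S k := by
    split_ifs with h
    · subst h
      simp only [sub_self, norm_zero, S]
      positivity
    · simpa using hbound k h
  have hsum0 : Summable fun k => a k - if k = 0 then a 0 else 0 :=
    Summable.of_norm_bounded (hSsum.mul_left (C * t)) hb
  have hsum1 : HasSum (fun k : ι → ℤ => if k = 0 then a 0 else 0) (a 0) := hasSum_ite_eq 0 (a 0)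
  have hsum : Summable a := by simpa using hsum0.add hsum1.summable
  have hP := hasSum_fourierIntegral_int (f := fun x => f (t • WithLp.toLp 2 x))
    (R := R / t) (hf.continuous.comp (by fun_prop))
    (fun x hx => by
      have h1 := hR _ (subset_tsupport f hx)
      rw [norm_smul, Real.norm_eq_abs, abs_of_pos ht] at h1
      rw [le_div_iff₀ ht, mul_comm]
      exact (mul_le_mul_of_nonneg_left (hle x) ht.le).trans h1)
    (by simpa only [integral_mFourier_smul_comp_smul f ht] using hsum)
  simp only [integral_mFourier_smul_comp_smul f ht] at hP
  have h0 : a 0 = 𝓕 f 0 / (t : ℂ) ^ Fintype.card ι := by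
    have : (WithLp.toLp 2 fun i => (((0 : ι → ℤ) i : ℤ) : ℝ)) = (0 : EuclideanSpace ℝ ι) := by
      ext; simp
    simp only [ha, this, smul_zero, Complex.real_smul]
    push_cast
    field_simp
  rw [← h0, ← (hP.sub hsum1).tsum_eq]
  calc _ ≤ ∑' k, C * t * S k := tsum_of_norm_bounded (hSsum.mul_left _).hasSum hb
    _ = _ := by rw [tsum_mul_left]; ring

end Scaling

section PartitionBump

/-- A smooth nonnegative function supported in `[-1, 1]` whose integer translates sum to `1`. -/
noncomputable def partitionBump (y : ℝ) : ℝ :=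
  Real.smoothTransition (y + 1) - Real.smoothTransition y

lemma partitionBump_contDiff : ContDiff ℝ (⊤ : ℕ∞) partitionBump :=
  (Real.smoothTransition.contDiff.comp (contDiff_id.add contDiff_const)).sub
    Real.smoothTransition.contDiff

lemma partitionBump_nonneg (y : ℝ) : 0 ≤ partitionBump y :=
  sub_nonneg.2 (Real.smoothTransition.monotone (by linarith))

lemma partitionBump_of_one_le {y : ℝ} (hy : 1 ≤ |y|) : partitionBump y = 0 := by
  rcases le_abs.1 hy with h | h
  · simp [partitionBump, Real.smoothTransition.one_of_one_le h,
      Real.smoothTransition.one_of_one_le (show 1 ≤ y + 1 by linarith)]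
  · simp [partitionBump, Real.smoothTransition.zero_of_nonpos (show y ≤ 0 by linarith),
      Real.smoothTransition.zero_of_nonpos (show y + 1 ≤ 0 by linarith)]

lemma exists_sum_partitionBump (l : ℝ) :
    ∃ s : Finset ℤ, (∀ m ∉ s, partitionBump (m + l) = 0) ∧
      ∑ m ∈ s, partitionBump (m + l) = 1 := by
  have h0 := Int.fract_nonneg l
  have h1 := Int.fract_lt_one l
  have hl := Int.floor_add_fract l
  refine ⟨{-⌊l⌋, -⌊l⌋ - 1}, fun m hm => partitionBump_of_one_le ?_, ?_⟩
  · simp only [Finset.mem_insert, Finset.mem_singleton, not_or] at hm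
    rcases lt_or_ge m (-⌊l⌋ - 1) with h | h
    · have : (m : ℝ) ≤ -⌊l⌋ - 2 := by exact_mod_cast (by omega : m ≤ -⌊l⌋ - 2)
      exact le_abs.2 (.inr (by linarith))
    · have : (-⌊l⌋ + 1 : ℝ) ≤ m := by exact_mod_cast (by omega : -⌊l⌋ + 1 ≤ m)
      exact le_abs.2 (.inl (by linarith))
  · rw [Finset.sum_pair (by omega)]
    have e1 : ((-⌊l⌋ : ℤ) : ℝ) + l = Int.fract l := by push_cast; linarith
    have e2 : ((-⌊l⌋ - 1 : ℤ) : ℝ) + l = Int.fract l - 1 := by push_cast; linarith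
    rw [e1, e2, partitionBump, partitionBump, Real.smoothTransition.one_of_one_le (by linarith),
      Real.smoothTransition.zero_of_nonpos (show Int.fract l - 1 ≤ 0 by linarith)]
    ring_nf

lemma tsum_prod_partitionBump {ι : Type*} [Fintype ι] (l : ι → ℝ) :
    ∑' e : ι → ℤ, ENNReal.ofReal (∏ j, partitionBump (e j + l j)) = 1 := by
  classical
  choose s hs hs1 using fun j => exists_sum_partitionBump (l j)
  rw [tsum_eq_sum (s := Fintype.piFinset s)]
  · rw [← ENNReal.ofReal_sum_of_nonneg
      fun e _ => Finset.prod_nonneg fun j _ => partitionBump_nonneg _,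
      ← Finset.prod_univ_sum s fun j m => partitionBump (m + l j)]
    simp [hs1]
  · intro e he
    simp only [Fintype.mem_piFinset, not_forall] at he
    obtain ⟨j, hj⟩ := he
    rw [Finset.prod_eq_zero (Finset.mem_univ j) (hs j _ hj), ENNReal.ofReal_zero]

end PartitionBump

namespace NumberField.mixedEmbedding

open NumberField.Units NumberField.Units.dirichletUnitTheorem Module fundamentalCone

variable {K}

open scoped Classical in
/-- The coordinates of the logarithmic embedding with respect to a system of fundamental units. -/
noncomputable def unitCoord (x : mixedSpace K) : Fin (rank K) → ℝ :=
  ((basisUnitLattice K).ofZLatticeBasis ℝ (unitLattice K)).equivFun (logMap x)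

open scoped Classical in
lemma unitCoord_smul {x : mixedSpace K} (hx : mixedEmbedding.norm x ≠ 0) (ζ : torsion K)
    (e : Fin (rank K) → ℤ) (j : Fin (rank K)) :
    unitCoord (((ζ : (𝓞 K)ˣ) * ∏ i, fundSystem K i ^ e i) • x) j = e j + unitCoord x j := by
  have h : logMap (((ζ : (𝓞 K)ˣ) * ∏ i, fundSystem K i ^ e i) • x) =
      ∑ i, (e i : ℝ) • ((basisUnitLattice K).ofZLatticeBasis ℝ (unitLattice K)) i + logMap x := by
    rw [logMap_unit_smul _ hx, ofMul_mul, map_add,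
      (logEmbedding_eq_zero_iff (x := (ζ : (𝓞 K)ˣ))).2 ζ.2, zero_add, ofMul_prod, map_sum]
    congr 1
    refine Finset.sum_congr rfl fun i _ => ?_
    rw [ofMul_zpow, map_zsmul, logEmbedding_fundSystem, Basis.ofZLatticeBasis_apply,
      Int.cast_smul_eq_zsmul]
  rw [unitCoord, h, map_add, Pi.add_apply, ← Basis.equivFun_symm_apply,
    LinearEquiv.apply_symm_apply, unitCoord]

/-- A smooth function of the logarithmic embedding whose sum over a unit orbit is constant. -/
noncomputable def unitWeight (x : mixedSpace K) : ℝ := ∏ j, partitionBump (unitCoord x j)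

lemma unitWeight_nonneg (x : mixedSpace K) : 0 ≤ unitWeight x :=
  Finset.prod_nonneg fun _ _ => partitionBump_nonneg _

lemma tsum_unitWeight {x : mixedSpace K} (hx : mixedEmbedding.norm x ≠ 0) :
    ∑' u : (𝓞 K)ˣ, ENNReal.ofReal (unitWeight (u • x)) = torsionOrder K := by
  have hbij : Function.Bijective fun p : torsion K × (Fin (rank K) → ℤ) =>
      (p.1 : (𝓞 K)ˣ) * ∏ i, fundSystem K i ^ p.2 i := by
    rw [Function.bijective_iff_existsUnique]
    intro u
    simpa only [eq_comm] using exist_unique_eq_mul_prod K u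
  rw [← (Equiv.ofBijective _ hbij).tsum_eq, ENNReal.tsum_prod']
  simp only [Equiv.ofBijective_apply, unitWeight, unitCoord_smul hx, tsum_prod_partitionBump]
  have := Fintype.ofFinite (torsion K)
  rw [tsum_fintype, torsionOrder]
  simp [Nat.card_eq_fintype_card]

end NumberField.mixedEmbedding

namespace NumberField.mixedEmbedding

open NumberField.Units NumberField.Units.dirichletUnitTheorem Module fundamentalCone

open scoped Classical

variable {K}

lemma contDiffAt_normAtPlace {n : WithTop ℕ∞} {w : InfinitePlace K} {x : mixedSpace K}
    (hx : normAtPlace w x ≠ 0) : ContDiffAt ℝ n (fun y : mixedSpace K => normAtPlace w y) x := by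
  by_cases hw : w.IsReal
  · simp only [normAtPlace_apply_of_isReal hw, norm_ne_zero_iff] at hx ⊢
    exact ContDiffAt.norm ℝ (by fun_prop) hx
  · rw [InfinitePlace.not_isReal_iff_isComplex] at hw
    simp only [normAtPlace_apply_of_isComplex hw, norm_ne_zero_iff] at hx ⊢
    exact ContDiffAt.norm ℝ (by fun_prop) hx

lemma contDiffAt_norm {n : WithTop ℕ∞} {x : mixedSpace K} (hx : mixedEmbedding.norm x ≠ 0) :
    ContDiffAt ℝ n (fun y : mixedSpace K => mixedEmbedding.norm y) x := by
  simp only [mixedEmbedding.norm_apply]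
  exact contDiffAt_prod fun w _ =>
    (contDiffAt_normAtPlace (mixedEmbedding.norm_ne_zero_iff.1 hx w)).pow _

lemma contDiffAt_logMap {n : WithTop ℕ∞} {x : mixedSpace K} (hx : mixedEmbedding.norm x ≠ 0) :
    ContDiffAt ℝ n (fun y : mixedSpace K => logMap y) x := by
  refine contDiffAt_pi.2 fun w => ?_
  simp only [logMap_apply]
  have h := mixedEmbedding.norm_ne_zero_iff.1 hx w
  exact contDiffAt_const.mul (((contDiffAt_normAtPlace h).log h).sub
    (((contDiffAt_norm hx).log hx).mul contDiffAt_const))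

lemma contDiffAt_unitWeight {x : mixedSpace K} (hx : mixedEmbedding.norm x ≠ 0) :
    ContDiffAt ℝ (⊤ : ℕ∞) (fun y : mixedSpace K => unitWeight y) x := by
  refine contDiffAt_prod fun j _ => partitionBump_contDiff.contDiffAt.comp x ?_
  let L := (LinearMap.proj j ∘ₗ
    (((basisUnitLattice K).ofZLatticeBasis ℝ (unitLattice K)).equivFun).toLinearMap).toContinuousLinearMap
  exact L.contDiff.contDiffAt.comp x (contDiffAt_logMap hx)

lemma contDiff_unitWeight_mul {g : ℝ → ℝ} (hg : ContDiff ℝ (⊤ : ℕ∞) g) {a : ℝ} (ha : 0 < a)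
    (hga : ∀ y, g y ≠ 0 → a ≤ y) :
    ContDiff ℝ (⊤ : ℕ∞) fun x : mixedSpace K => unitWeight x * g (mixedEmbedding.norm x) := by
  refine contDiff_iff_contDiffAt.2 fun x => ?_
  by_cases hx : mixedEmbedding.norm x = 0
  · have : ∀ᶠ y in 𝓝 x, mixedEmbedding.norm y < a :=
      (mixedEmbedding.continuous_norm K).continuousAt.eventually_lt continuousAt_const (by rwa [hx])
    refine (contDiffAt_const (c := (0 : ℝ))).congr_of_eventuallyEq ?_
    filter_upwards [this] with y hy
    rw [not_ne_iff.1 fun h => hy.not_ge (hga _ h), mul_zero]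
  · exact (contDiffAt_unitWeight hx).mul (hg.contDiffAt.comp x (contDiffAt_norm hx))

lemma norm_logMap_le_of_unitWeight_ne_zero :
    ∃ B, ∀ x : mixedSpace K, unitWeight x ≠ 0 → ‖logMap x‖ ≤ B := by
  set b := (basisUnitLattice K).ofZLatticeBasis ℝ (unitLattice K) with hb
  refine ⟨∑ j, ‖b j‖, fun x hx => ?_⟩
  have h : logMap x = ∑ j, unitCoord x j • b j := (b.sum_equivFun (logMap x)).symm
  rw [h]
  refine norm_sum_le_of_le _ fun j _ => ?_
  rw [_root_.norm_smul]
  refine mul_le_of_le_one_left (norm_nonneg _) (not_lt.1 fun hj => hx ?_)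
  exact Finset.prod_eq_zero (Finset.mem_univ j) (partitionBump_of_one_le hj.le)

lemma hasCompactSupport_unitWeight_mul {g : ℝ → ℝ} {a : ℝ} (ha : 0 < a)
    (hga : ∀ y, g y ≠ 0 → a ≤ y ∧ y ≤ 1) :
    HasCompactSupport fun x : mixedSpace K => unitWeight x * g (mixedEmbedding.norm x) := by
  obtain ⟨B, hB⟩ := norm_logMap_le_of_unitWeight_ne_zero (K := K)
  set A : ℝ := -Real.log a with hA
  set M : ℝ := ∑ w : InfinitePlace K, w.mult * (B + A) with hM
  refine HasCompactSupport.of_support_subset_isCompact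
    (isCompact_closedBall (0 : mixedSpace K) (Real.exp (B + A + M))) fun x hx => ?_
  have hW := hB x (left_ne_zero_of_mul hx)
  obtain ⟨h1, h2⟩ := hga _ (right_ne_zero_of_mul hx)
  have hpos : 0 < mixedEmbedding.norm x := ha.trans_le h1
  have hw (w) : 0 < normAtPlace w x :=
    (normAtPlace_nonneg w x).lt_of_ne' (mixedEmbedding.norm_ne_zero_iff.1 hpos.ne' w)
  have hl1 : Real.log (mixedEmbedding.norm x) ≤ 0 := Real.log_nonpos hpos.le h2
  have hl2 : -A ≤ Real.log (mixedEmbedding.norm x) := by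
    rw [hA, neg_neg]; exact Real.log_le_log ha h1
  have hB0 : 0 ≤ B := (norm_nonneg _).trans hW
  have hA0 : 0 ≤ A := by linarith
  have hn : (1 : ℝ) ≤ finrank ℚ K := by exact_mod_cast finrank_pos (R := ℚ) (M := K)
  have hne (w : InfinitePlace K) (hw0 : w ≠ w₀) :
      |w.mult * Real.log (normAtPlace w x)| ≤ w.mult * (B + A) := by
    have h3 := (norm_le_pi_norm (logMap x) ⟨w, hw0⟩).trans hW
    rw [Real.norm_eq_abs, logMap_apply] at h3
    have hm : (1 : ℝ) ≤ w.mult := by exact_mod_cast InfinitePlace.mult_pos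
    have h4 : |w.mult * (Real.log (mixedEmbedding.norm x) * (finrank ℚ K : ℝ)⁻¹)| ≤ w.mult * A := by
      rw [abs_mul, abs_mul, Nat.abs_cast, abs_of_nonpos hl1, abs_of_nonneg (by positivity)]
      gcongr
      exact (mul_le_of_le_one_right (by linarith) (inv_le_one_of_one_le₀ hn)).trans (by linarith)
    have h5 : w.mult * Real.log (normAtPlace w x) =
        w.mult * (Real.log (normAtPlace w x) -
          Real.log (mixedEmbedding.norm x) * (finrank ℚ K : ℝ)⁻¹) +
        w.mult * (Real.log (mixedEmbedding.norm x) * (finrank ℚ K : ℝ)⁻¹) := by ring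
    rw [h5]
    refine (abs_add_le _ _).trans ?_
    nlinarith
  have hall (w : InfinitePlace K) : Real.log (normAtPlace w x) ≤ B + A + M := by
    have hm : (1 : ℝ) ≤ w.mult := by exact_mod_cast InfinitePlace.mult_pos
    have hM0 : 0 ≤ M := Finset.sum_nonneg fun w _ => by positivity
    suffices h : w.mult * Real.log (normAtPlace w x) ≤ w.mult * (B + A) + M by
      have h6 : w.mult * Real.log (normAtPlace w x) ≤ w.mult * (B + A + M) := by nlinarith
      exact le_of_mul_le_mul_left h6 (by linarith)
    by_cases hw0 : w = w₀
    · have hsum : Real.log (mixedEmbedding.norm x) =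
          ∑ w : InfinitePlace K, w.mult * Real.log (normAtPlace w x) := by
        rw [mixedEmbedding.norm_apply, Real.log_prod fun w _ => pow_ne_zero _ (hw w).ne']
        exact Finset.sum_congr rfl fun w _ => Real.log_pow _ _
      rw [← Finset.add_sum_erase _ _ (Finset.mem_univ w)] at hsum
      have h7 : -∑ v ∈ Finset.univ.erase w, v.mult * Real.log (normAtPlace v x) ≤ M := by
        rw [← Finset.sum_neg_distrib]
        refine (Finset.sum_le_sum fun v hv => (neg_le_abs _).trans
          (hne v (hw0 ▸ Finset.ne_of_mem_erase hv))).trans ?_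
        exact Finset.sum_le_sum_of_subset_of_nonneg (Finset.erase_subset _ _)
          fun v _ _ => by positivity
      have : 0 ≤ w.mult * (B + A) := by positivity
      linarith
    · linarith [(le_abs_self _).trans (hne w hw0)]
  rw [mem_closedBall_zero_iff, norm_eq_sup'_normAtPlace]
  refine Finset.sup'_le _ _ fun w _ => ?_
  rw [← Real.exp_log (hw w)]
  exact Real.exp_le_exp.2 (hall w)

end NumberField.mixedEmbedding

namespace NumberField.mixedEmbedding

open NumberField.Units Module fundamentalCone
open scoped nonZeroDivisors

variable {K}

lemma exists_equiv_prod_units {C : ClassGroup (𝓞 K)} {J : (Ideal (𝓞 K))⁰}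
    (hJ : ClassGroup.mk0 J = C⁻¹) :
    ∃ (x₀ : {I : (Ideal (𝓞 K))⁰ // ClassGroup.mk0 I = C} → 𝓞 K)
      (e : {I : (Ideal (𝓞 K))⁰ // ClassGroup.mk0 I = C} × (𝓞 K)ˣ ≃
        {x : 𝓞 K // x ∈ (J : Ideal (𝓞 K)) ∧ x ≠ 0}),
      (∀ I, Ideal.span {x₀ I} = (J : Ideal (𝓞 K)) * (I.1 : Ideal (𝓞 K))) ∧
        ∀ I u, (e (I, u) : 𝓞 K) = u * x₀ I := by
  have hJ0 : (J : Ideal (𝓞 K)) ≠ 0 := nonZeroDivisors.coe_ne_zero J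
  have hprin (I : {I : (Ideal (𝓞 K))⁰ // ClassGroup.mk0 I = C}) :
      ∃ x, Ideal.span {x} = (J : Ideal (𝓞 K)) * (I.1 : Ideal (𝓞 K)) := by
    have h : ClassGroup.mk0 (J * I.1) = 1 := by rw [map_mul, hJ, I.2, inv_mul_cancel]
    obtain ⟨x, hx⟩ := ((ClassGroup.mk0_eq_one_iff (J * I.1).2).1 h).principal
    exact ⟨x, hx.symm⟩
  choose x₀ hx₀ using hprin
  have hx₀0 (I) : x₀ I ≠ 0 := by
    intro h
    have := hx₀ I
    rw [h, Ideal.span_singleton_eq_bot.2 rfl] at this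
    exact mul_ne_zero hJ0 (nonZeroDivisors.coe_ne_zero I.1) this.symm
  have hmem (I) (u : (𝓞 K)ˣ) : (u * x₀ I : 𝓞 K) ∈ (J : Ideal (𝓞 K)) ∧ (u * x₀ I : 𝓞 K) ≠ 0 := by
    have h : x₀ I ∈ (J : Ideal (𝓞 K)) * (I.1 : Ideal (𝓞 K)) := by
      rw [← hx₀]
      exact Ideal.mem_span_singleton_self _
    exact ⟨Ideal.mul_mem_left _ _ (Ideal.mul_le_left h), mul_ne_zero u.ne_zero (hx₀0 I)⟩
  refine ⟨x₀, Equiv.ofBijective (fun p => ⟨p.2 * x₀ p.1, hmem p.1 p.2⟩) ⟨?_, ?_⟩, hx₀,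
    fun I u => rfl⟩
  · rintro ⟨I, u⟩ ⟨I', u'⟩ h
    have h : (u * x₀ I : 𝓞 K) = u' * x₀ I' := congrArg Subtype.val h
    have hspan : Ideal.span {x₀ I} = Ideal.span {x₀ I'} := by
      rw [← Ideal.span_singleton_mul_left_unit u.isUnit, h,
        Ideal.span_singleton_mul_left_unit u'.isUnit]
    rw [hx₀, hx₀] at hspan
    obtain rfl : I = I' := Subtype.ext (Subtype.ext (mul_left_cancel₀ hJ0 hspan))
    obtain rfl : u = u' := Units.ext (mul_right_cancel₀ (hx₀0 I) h)
    rfl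
  · rintro ⟨x, hx, hx0⟩
    obtain ⟨I, hI⟩ := Ideal.dvd_iff_le.2 ((Ideal.span_singleton_le_iff_mem _).2 hx)
    have hI0 : I ≠ 0 := by
      rintro rfl
      rw [mul_zero] at hI
      exact hx0 (Ideal.span_singleton_eq_bot.1 hI)
    let I' : (Ideal (𝓞 K))⁰ := ⟨I, mem_nonZeroDivisors_of_ne_zero hI0⟩
    have hC : ClassGroup.mk0 I' = C := by
      have h : ClassGroup.mk0 (J * I') = 1 :=
        (ClassGroup.mk0_eq_one_iff (J * I').2).2 ⟨x, hI.symm⟩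
      rw [map_mul, hJ, inv_mul_eq_one] at h
      exact h.symm
    have hassoc := Ideal.span_singleton_eq_span_singleton.1 ((hx₀ ⟨I', hC⟩).trans hI.symm)
    obtain ⟨u, hu⟩ := hassoc
    exact ⟨(⟨I', hC⟩, u), Subtype.ext ((mul_comm _ _).trans hu)⟩

lemma norm_mixedEmbedding_eq_absNorm (x : 𝓞 K) :
    mixedEmbedding.norm (mixedEmbedding K x) = Ideal.absNorm (Ideal.span {x}) := by
  rw [norm_eq_norm, Ideal.absNorm_span_singleton, ← Algebra.coe_norm_int]
  simp

lemma tsum_unitWeight_mul {C : ClassGroup (𝓞 K)} {J : (Ideal (𝓞 K))⁰}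
    (hJ : ClassGroup.mk0 J = C⁻¹) {g : ℝ → ℝ} {τ : ℝ} (hτ : 0 < τ) :
    ∑' x : {x : 𝓞 K // x ∈ (J : Ideal (𝓞 K)) ∧ x ≠ 0},
      ENNReal.ofReal (unitWeight (τ • mixedEmbedding K x.1) *
        g (mixedEmbedding.norm (τ • mixedEmbedding K x.1))) =
    torsionOrder K * ∑' I : {I : (Ideal (𝓞 K))⁰ // ClassGroup.mk0 I = C},
      ENNReal.ofReal (g (τ ^ finrank ℚ K * Ideal.absNorm (J : Ideal (𝓞 K)) *
        Ideal.absNorm (I.1 : Ideal (𝓞 K)))) := by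
  obtain ⟨x₀, e, hx₀, he⟩ := exists_equiv_prod_units hJ
  rw [← e.tsum_eq, ENNReal.tsum_prod', ← ENNReal.tsum_mul_left]
  refine tsum_congr fun I => ?_
  have hN : mixedEmbedding.norm (τ • mixedEmbedding K (x₀ I)) = τ ^ finrank ℚ K *
      Ideal.absNorm (J : Ideal (𝓞 K)) * Ideal.absNorm (I.1 : Ideal (𝓞 K)) := by
    rw [norm_smul, norm_mixedEmbedding_eq_absNorm, hx₀, map_mul, abs_of_pos hτ]
    push_cast
    ring
  have hN0 : mixedEmbedding.norm (τ • mixedEmbedding K (x₀ I)) ≠ 0 := by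
    rw [hN]
    have h1 := Ideal.absNorm_ne_zero_of_nonZeroDivisors J
    have h2 := Ideal.absNorm_ne_zero_of_nonZeroDivisors I.1
    positivity
  have hu (u : (𝓞 K)ˣ) : τ • mixedEmbedding K ((e (I, u)).1 : K) =
      u • (τ • mixedEmbedding K (x₀ I)) := by
    rw [he, unitSMul_smul, mul_smul_comm, RingOfIntegers.coe_eq_algebraMap, map_mul, map_mul]
  simp only [hu, norm_unit_smul, hN, ENNReal.ofReal_mul (unitWeight_nonneg _)]
  rw [ENNReal.tsum_mul_right, tsum_unitWeight hN0]

end NumberField.mixedEmbedding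

lemma hasFiniteSupport_comp_smul_int {ι : Type*} [Fintype ι] {f : EuclideanSpace ℝ ι → ℂ}
    (hs : HasCompactSupport f) {t : ℝ} (ht : 0 < t) :
    (Function.support fun m : ι → ℤ => f (t • WithLp.toLp 2 fun i => (m i : ℝ))).Finite := by
  obtain ⟨R, hR⟩ := hs.isBounded.exists_norm_le
  classical
  refine (Set.finite_Icc (fun _ : ι => ⌊-(R / t)⌋) (fun _ : ι => ⌈R / t⌉)).subset fun m hm => ?_
  have h1 := hR _ (subset_tsupport f hm)
  have h2 (i : ι) : |(m i : ℝ)| ≤ R / t := by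
    rw [le_div_iff₀ ht, mul_comm]
    refine le_trans ?_ ((PiLp.norm_apply_le _ i).trans h1)
    simp [abs_of_pos ht]
  refine ⟨fun i => ?_, fun i => ?_⟩
  · exact Int.floor_le_iff.2 (by linarith [(abs_le.1 (h2 i)).1])
  · exact Int.le_ceil_iff.2 (by linarith [(abs_le.1 (h2 i)).2])

namespace NumberField.mixedEmbedding

open NumberField.Units Module Module.Free fundamentalCone
open scoped nonZeroDivisors Classical

variable {K}

lemma tsum_fractionalIdealLatticeBasis (J : (Ideal (𝓞 K))⁰) {φ : mixedSpace K → ENNReal}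
    (hφ : φ 0 = 0) :
    ∑' m : ChooseBasisIndex ℤ (FractionalIdeal.mk0 K J) → ℤ,
        φ (∑ i, (m i : ℝ) • fractionalIdealLatticeBasis K (FractionalIdeal.mk0 K J) i) =
      ∑' x : {x : 𝓞 K // x ∈ (J : Ideal (𝓞 K)) ∧ x ≠ 0}, φ (mixedEmbedding K x.1) := by
  set B := fractionalIdealLatticeBasis K (FractionalIdeal.mk0 K J) with hB
  have hinj : Function.Injective fun m : ChooseBasisIndex ℤ (FractionalIdeal.mk0 K J) → ℤ =>
      ∑ i, (m i : ℝ) • B i := by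
    intro m m' h
    ext i
    have h1 := B.repr_sum_self fun i => (m i : ℝ)
    have h2 := B.repr_sum_self fun i => (m' i : ℝ)
    exact Int.cast_injective
      (congrFun (h1.symm.trans ((congrArg (fun x => ⇑(B.repr x)) h).trans h2)) i)
  have hinj' : Function.Injective fun x : {x : 𝓞 K // x ∈ (J : Ideal (𝓞 K)) ∧ x ≠ 0} =>
      mixedEmbedding K (x.1 : K) :=
    fun x y h => Subtype.ext (RingOfIntegers.coe_injective (mixedEmbedding_injective K h))
  rw [← tsum_range φ hinj, ← tsum_range φ hinj', tsum_subtype, tsum_subtype]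
  refine tsum_congr fun y => ?_
  rcases eq_or_ne y 0 with rfl | hy
  · simp [Set.indicator_apply, hφ]
  have hiff : y ∈ Set.range (fun m : ChooseBasisIndex ℤ (FractionalIdeal.mk0 K J) → ℤ =>
      ∑ i, (m i : ℝ) • B i) ↔ y ∈ Set.range (fun x : {x : 𝓞 K // x ∈ (J : Ideal (𝓞 K)) ∧ x ≠ 0} =>
      mixedEmbedding K (x.1 : K)) := by
    have h1 := mem_span_fractionalIdealLatticeBasis K (FractionalIdeal.mk0 K J) (x := y)
    rw [Submodule.mem_span_range_iff_exists_fun] at h1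
    simp only [Set.mem_range, ← Int.cast_smul_eq_zsmul ℝ] at h1 ⊢
    rw [h1]
    constructor
    · rintro ⟨z, hz, rfl⟩
      simp only [FractionalIdeal.coe_mk0, SetLike.mem_coe, FractionalIdeal.mem_coeIdeal] at hz
      obtain ⟨x, hx, rfl⟩ := hz
      exact ⟨⟨x, hx, by rintro rfl; simp at hy⟩, rfl⟩
    · rintro ⟨x, rfl⟩
      refine ⟨_, ?_, rfl⟩
      simp only [FractionalIdeal.coe_mk0, SetLike.mem_coe, FractionalIdeal.mem_coeIdeal]
      exact ⟨x.1, x.2.1, rfl⟩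
  simp only [Set.indicator_apply, hiff]

lemma exists_abs_tsum_class_sub_le {g : ℝ → ℝ} (hg : ContDiff ℝ (⊤ : ℕ∞) g) (hg0 : ∀ y, 0 ≤ g y)
    {a : ℝ} (ha : 0 < a) (hga : ∀ y, g y ≠ 0 → a ≤ y ∧ y ≤ 1) (C : ClassGroup (𝓞 K)) :
    ∃ c D : ℝ, ∀ t : ℝ, 0 < t →
      |(∑' I : {I : (Ideal (𝓞 K))⁰ // ClassGroup.mk0 I = C},
        ENNReal.ofReal (g (t * Ideal.absNorm (I.1 : Ideal (𝓞 K))))).toReal - c / t| ≤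
          D * t ^ ((finrank ℚ K : ℝ)⁻¹) := by
  obtain ⟨J, hJ⟩ := ClassGroup.mk0_surjective C⁻¹
  set N : ℝ := (Ideal.absNorm (J : Ideal (𝓞 K)) : ℝ) with hN
  have hNpos : 0 < N := by
    have : Ideal.absNorm (J : Ideal (𝓞 K)) ≠ 0 := Ideal.absNorm_ne_zero_of_nonZeroDivisors J
    positivity
  set φ : mixedSpace K → ℝ := fun x => unitWeight x * g (mixedEmbedding.norm x) with hφ
  have hφ0 (x) : 0 ≤ φ x := mul_nonneg (unitWeight_nonneg x) (hg0 _)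
  set B := fractionalIdealLatticeBasis K (FractionalIdeal.mk0 K J) with hB
  set L := (EuclideanSpace.equiv (ChooseBasisIndex ℤ (FractionalIdeal.mk0 K J)) ℝ).trans
    B.equivFunL.symm with hL
  have hLsum (t : ℝ) (m : ChooseBasisIndex ℤ (FractionalIdeal.mk0 K J) → ℤ) :
      L (t • WithLp.toLp 2 fun i => (m i : ℝ)) = t • ∑ i, (m i : ℝ) • B i := by
    rw [map_smul]
    congr 1
    exact B.equivFun_symm_apply _
  set f : EuclideanSpace ℝ (ChooseBasisIndex ℤ (FractionalIdeal.mk0 K J)) → ℂ :=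
    fun v => (φ (L v) : ℂ) with hf
  have hfc : ContDiff ℝ (⊤ : ℕ∞) f :=
    Complex.ofRealCLM.contDiff.comp ((contDiff_unitWeight_mul hg ha fun y hy => (hga y hy).1).comp
      L.contDiff)
  have hfs : HasCompactSupport f := by
    have h1 : HasCompactSupport (φ ∘ L) :=
      (hasCompactSupport_unitWeight_mul ha hga).comp_homeomorph L.toHomeomorph
    exact h1.comp_left (g := fun x : ℝ => (x : ℂ)) Complex.ofReal_zero
  obtain ⟨c, D, hcD⟩ := exists_norm_finsum_smul_sub_le hfc hfs
  have hcard : Fintype.card (ChooseBasisIndex ℤ (FractionalIdeal.mk0 K J)) = finrank ℚ K := by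
    rw [← finrank_eq_card_basis B, mixedEmbedding.finrank]
  set n := finrank ℚ K with hn
  have hn0 : n ≠ 0 := finrank_pos.ne'
  set w : ℝ := (torsionOrder K : ℝ) with hw
  have hwpos : 0 < w := by
    have := (torsionOrder K).pos_of_ne_zero (torsionOrder_ne_zero K)
    positivity
  set S : ℝ → ℝ := fun t => (∑' I : {I : (Ideal (𝓞 K))⁰ // ClassGroup.mk0 I = C},
        ENNReal.ofReal (g (t * Ideal.absNorm (I.1 : Ideal (𝓞 K))))).toReal with hS
  have hsum (τ : ℝ) (hτ : 0 < τ) :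
      ∑ᶠ m : ChooseBasisIndex ℤ (FractionalIdeal.mk0 K J) → ℤ,
        f (τ • WithLp.toLp 2 fun i => (m i : ℝ)) = ((w * S (τ ^ n * N) : ℝ) : ℂ) := by
    rw [← tsum_eq_finsum (L := .unconditional _) (hasFiniteSupport_comp_smul_int hfs hτ)]
    have h1 := tsum_fractionalIdealLatticeBasis J (φ := fun x => ENNReal.ofReal (φ (τ • x)))
      (by
        have : g 0 = 0 := by
          by_contra h
          linarith [(hga 0 h).1]
        simp [hφ, this])
    rw [tsum_unitWeight_mul hJ hτ] at h1
    have h2 := congrArg ENNReal.toReal h1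
    rw [ENNReal.toReal_mul, ENNReal.tsum_toReal_eq (fun _ => ENNReal.ofReal_ne_top)] at h2
    simp only [ENNReal.toReal_ofReal (hφ0 _), ENNReal.toReal_natCast] at h2
    rw [← hw, ← hN] at h2
    rw [← h2, Complex.ofReal_tsum]
    simp only [hf, hLsum]
    rfl
  refine ⟨c.re * N / w, D * (N⁻¹) ^ ((n : ℝ)⁻¹) / w, fun t ht => ?_⟩
  set τ : ℝ := (t * N⁻¹) ^ ((n : ℝ)⁻¹) with hτ
  have htN : 0 < t * N⁻¹ := by positivity
  have hτpos : 0 < τ := Real.rpow_pos_of_pos htN _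
  have hτn : τ ^ n = t * N⁻¹ := Real.rpow_inv_natCast_pow htN.le hn0
  have h1 := hcD τ hτpos
  rw [hsum τ hτpos, hcard, ← Complex.ofReal_pow, hτn, inv_mul_cancel_right₀ hNpos.ne'] at h1
  have h2 := (Complex.abs_re_le_norm _).trans h1
  rw [Complex.sub_re, Complex.ofReal_re, Complex.div_ofReal_re] at h2
  have h3 : S t - c.re * N / w / t = (w * S t - c.re / (t * N⁻¹)) / w := by
    field_simp
  have h4 : τ = t ^ ((n : ℝ)⁻¹) * N⁻¹ ^ ((n : ℝ)⁻¹) := Real.mul_rpow ht.le (by positivity)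
  change |S t - _| ≤ _
  rw [h3, abs_div, abs_of_pos hwpos]
  calc _ ≤ D * τ / w := by gcongr
    _ = _ := by rw [h4]; ring

end NumberField.mixedEmbedding

namespace NumberField

open Module
open scoped nonZeroDivisors

lemma finite_support_comp_mul_absNorm {g : ℝ → ℝ} (hga : ∀ y, g y ≠ 0 → y ≤ 1) {t : ℝ}
    (ht : 0 < t) :
    (Function.support fun I : (Ideal (𝓞 K))⁰ =>
      g (t * Ideal.absNorm (I : Ideal (𝓞 K)))).Finite := by
  have h := (Ideal.finite_setOfPred_absNorm_le (S := 𝓞 K) ⌊t⁻¹⌋₊).preimage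
    (f := fun I : (Ideal (𝓞 K))⁰ => (I : Ideal (𝓞 K))) Subtype.val_injective.injOn
  refine h.subset fun I hI => ?_
  have h1 := hga _ hI
  rw [← le_div_iff₀' ht, one_div] at h1
  exact Nat.le_floor h1

/-- Smooth counting of ideals by their norm, with a power saving error term. -/
theorem exists_abs_tsum_ideal_sub_le {g : ℝ → ℝ} (hg : ContDiff ℝ (⊤ : ℕ∞) g)
    (hg0 : ∀ y, 0 ≤ g y) {a : ℝ} (ha : 0 < a) (hga : ∀ y, g y ≠ 0 → a ≤ y ∧ y ≤ 1) :
    ∃ c D : ℝ, ∀ t : ℝ, 0 < t →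
      |∑' I : (Ideal (𝓞 K))⁰, g (t * Ideal.absNorm (I : Ideal (𝓞 K))) - c / t| ≤
        D * t ^ ((finrank ℚ K : ℝ)⁻¹) := by
  choose c D hcD using mixedEmbedding.exists_abs_tsum_class_sub_le hg hg0 ha hga (K := K)
  refine ⟨∑ C, c C, ∑ C, D C, fun t ht => ?_⟩
  have hsum : Summable fun I : (Ideal (𝓞 K))⁰ => g (t * Ideal.absNorm (I : Ideal (𝓞 K))) :=
    summable_of_hasFiniteSupport (finite_support_comp_mul_absNorm K (fun y hy => (hga y hy).2) ht)
  have hsum' := (Equiv.sigmaFiberEquiv (ClassGroup.mk0 (R := 𝓞 K))).summable_iff.2 hsum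
  have hG := (Equiv.sigmaFiberEquiv (ClassGroup.mk0 (R := 𝓞 K))).tsum_eq
    fun I : (Ideal (𝓞 K))⁰ => g (t * Ideal.absNorm (I : Ideal (𝓞 K)))
  rw [← hG, show ∑' c, g (t * Ideal.absNorm
    ((Equiv.sigmaFiberEquiv (ClassGroup.mk0 (R := 𝓞 K)) c : (Ideal (𝓞 K))⁰) : Ideal (𝓞 K))) = _ from
    Summable.tsum_sigma hsum', tsum_fintype,
    Finset.sum_div, ← Finset.sum_sub_distrib, Finset.sum_mul]
  refine (Finset.abs_sum_le_sum_abs _ _).trans (Finset.sum_le_sum fun C _ => ?_)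
  have h := hcD C t ht
  rw [ENNReal.tsum_toReal_eq (fun _ => ENNReal.ofReal_ne_top)] at h
  simp only [ENNReal.toReal_ofReal (hg0 _)] at h
  exact h

end NumberField

section Mellin

open Set

lemma integral_norm_cpow_smul (f : ℝ → ℂ) (s : ℂ) :
    ∫ t in Ioi (0 : ℝ), ‖(t : ℂ) ^ (s - 1) • f t‖ =
      (mellin (fun t => (‖f t‖ : ℂ)) (s.re : ℂ)).re := by
  have h : mellin (fun t => (‖f t‖ : ℂ)) (s.re : ℂ) =
      ((∫ t in Ioi (0 : ℝ), ‖(t : ℂ) ^ (s - 1) • f t‖ : ℝ) : ℂ) := by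
    rw [mellin, ← integral_complex_ofReal]
    refine setIntegral_congr_fun measurableSet_Ioi fun t ht => ?_
    have h1 : ‖(t : ℂ) ^ (s - 1) * f t‖ = t ^ (s.re - 1) * ‖f t‖ := by
      rw [norm_mul, Complex.norm_cpow_eq_rpow_re_of_pos ht, Complex.sub_re, Complex.one_re]
    simp only [smul_eq_mul, h1]
    push_cast [Complex.ofReal_cpow (le_of_lt ht)]
    rfl
  rw [h, Complex.ofReal_re]

lemma isBigO_atTop_of_forall_le_one {f : ℝ → ℂ} (hf : ∀ y, f y ≠ 0 → y ≤ 1) (g : ℝ → ℝ) :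
    f =O[atTop] g := by
  refine Asymptotics.IsBigO.of_bound 0 ?_
  filter_upwards [eventually_gt_atTop 1] with t ht
  have : f t = 0 := not_not.1 fun h => ht.not_ge (hf t h)
  simp [this]

lemma isBigO_nhdsGT_zero_of_forall_le {f : ℝ → ℂ} {a : ℝ} (ha : 0 < a)
    (hf : ∀ y, f y ≠ 0 → a ≤ y) (g : ℝ → ℝ) : f =O[𝓝[>] 0] g := by
  refine Asymptotics.IsBigO.of_bound 0 ?_
  filter_upwards [nhdsWithin_le_nhds (eventually_lt_nhds ha)] with t ht
  have : f t = 0 := not_not.1 fun h => ht.not_ge (hf t h)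
  simp [this]

lemma mellinConvergent_of_continuous {f : ℝ → ℂ} (hf : Continuous f) {a : ℝ} (ha : 0 < a)
    (hfa : ∀ y, f y ≠ 0 → a ≤ y ∧ y ≤ 1) (s : ℂ) : MellinConvergent f s :=
  mellinConvergent_of_isBigO_rpow (hf.locallyIntegrable.locallyIntegrableOn _)
    (isBigO_atTop_of_forall_le_one (fun y hy => (hfa y hy).2) _) (lt_add_one s.re)
    (isBigO_nhdsGT_zero_of_forall_le ha (fun y hy => (hfa y hy).1) _) (sub_one_lt s.re)

lemma differentiable_mellin {f : ℝ → ℂ} (hf : Continuous f) {a : ℝ} (ha : 0 < a)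
    (hfa : ∀ y, f y ≠ 0 → a ≤ y ∧ y ≤ 1) : Differentiable ℂ (mellin f) := fun s =>
  mellin_differentiableAt_of_isBigO_rpow (hf.locallyIntegrable.locallyIntegrableOn _)
    (isBigO_atTop_of_forall_le_one (fun y hy => (hfa y hy).2) _) (lt_add_one s.re)
    (isBigO_nhdsGT_zero_of_forall_le ha (fun y hy => (hfa y hy).1) _) (sub_one_lt s.re)

lemma hasSum_mellin_comp_mul {ι : Type*} {N : ι → ℝ} (hN : ∀ i, 0 < N i) {s : ℂ}
    (hsum : Summable fun i => N i ^ (-s.re)) {f : ℝ → ℂ} (hf : Continuous f) {a : ℝ} (ha : 0 < a)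
    (hfa : ∀ y, f y ≠ 0 → a ≤ y ∧ y ≤ 1) :
    HasSum (fun i => (N i : ℂ) ^ (-s) * mellin f s) (mellin (fun t => ∑' i, f (t * N i)) s) := by
  have : Countable ι := by
    have h := hsum.countable_support
    rw [show (Function.support fun i => N i ^ (-s.re)) = univ from
      eq_univ_of_forall fun i => (Real.rpow_pos_of_pos (hN i) _).ne'] at h
    exact countable_univ_iff.1 h
  have h := hasSum_integral_of_summable_integral_norm (μ := volume.restrict (Ioi (0 : ℝ)))
    (F := fun i (t : ℝ) => (t : ℂ) ^ (s - 1) • f (t * N i)) (fun i => ?_) ?_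
  · have h1 (i : ι) : ∫ t in Ioi (0 : ℝ), (t : ℂ) ^ (s - 1) • f (t * N i) =
        (N i : ℂ) ^ (-s) * mellin f s := mellin_comp_mul_right f s (hN i)
    simp only [h1] at h
    simpa only [mellin, smul_eq_mul, tsum_mul_left] using h
  · simpa only [mul_comm, MellinConvergent, IntegrableOn] using
      (MellinConvergent.comp_mul_left (hN i)).2 (mellinConvergent_of_continuous hf ha hfa s)
  · refine (hsum.mul_right (mellin (fun t => (‖f t‖ : ℂ)) (s.re : ℂ)).re).congr fun i => ?_
    rw [integral_norm_cpow_smul (fun t => f (t * N i)),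
      mellin_comp_mul_right (fun t => (‖f t‖ : ℂ)) _ (hN i), ← Complex.ofReal_neg,
      ← Complex.ofReal_cpow (hN i).le, smul_eq_mul, Complex.re_ofReal_mul]

/-- Continuation of a Dirichlet series, smoothed by the Mellin transform of a weight `g`, to the
right half plane, from an asymptotic expansion with a power saving of the `g`-smoothed
summatory function. -/
theorem exists_mellin_mul_tsum_eq {ι : Type*} {N : ι → ℝ} (hN : ∀ i, 1 ≤ N i)
    (hsum : ∀ σ : ℝ, 1 < σ → Summable fun i => N i ^ (-σ)) {g : ℝ → ℝ} (hg : Continuous g)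
    (hg0 : ∀ y, 0 ≤ g y) {a : ℝ} (ha : 0 < a) (hga : ∀ y, g y ≠ 0 → a ≤ y ∧ y ≤ 1)
    {c D δ : ℝ} (hδ : 0 < δ) (hD : ∀ t, 0 < t → |∑' i, g (t * N i) - c / t| ≤ D * t ^ δ) :
    ∃ F : ℂ → ℂ, DifferentiableOn ℂ F {s | 0 < s.re} ∧ (∃ M, ∀ s, 0 < s.re → ‖F s‖ ≤ M) ∧
      ∀ s : ℂ, 1 < s.re →
        mellin (fun t => (g t : ℂ)) s * ∑' i, (N i : ℂ) ^ (-s) = F s + c / (s - 1) := by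
  have hNpos (i) : 0 < N i := one_pos.trans_le (hN i)
  have : Countable ι := by
    have h := (hsum 2 one_lt_two).countable_support
    rw [show (Function.support fun i => N i ^ (-2 : ℝ)) = univ from
      eq_univ_of_forall fun i => (Real.rpow_pos_of_pos (hNpos i) _).ne'] at h
    exact countable_univ_iff.1 h
  set G : ℝ → ℝ := fun t => ∑' i, g (t * N i) with hG
  have hGm : Measurable G := by
    have : G = fun t => (∑' i, ENNReal.ofReal (g (t * N i))).toReal := by
      funext t
      rw [ENNReal.tsum_toReal_eq (fun _ => ENNReal.ofReal_ne_top)]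
      simp only [ENNReal.toReal_ofReal (hg0 _), hG]
    rw [this]
    exact (Measurable.tsum fun i => by fun_prop).ennreal_toReal
  have hG1 (t : ℝ) (ht : 1 < t) : G t = 0 := by
    rw [hG, ← tsum_zero (α := ℝ) (β := ι)]
    refine tsum_congr fun i => ?_
    by_contra h
    nlinarith [(hga _ h).2, hN i]
  have hD0 : 0 ≤ D := by simpa using (abs_nonneg _).trans (hD 1 one_pos)
  set R : ℝ → ℂ := indicator (Ioc 0 1) fun t => ((G t - c / t : ℝ) : ℂ) with hR
  have hRm : Measurable R := by
    refine Measurable.indicator ?_ measurableSet_Ioc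
    fun_prop
  have hRle (t : ℝ) (ht : 0 < t) : ‖R t‖ ≤ D * t ^ δ := by
    by_cases h : t ∈ Ioc (0 : ℝ) 1
    · rw [hR, indicator_of_mem h, Complex.norm_real]
      exact hD t ht
    · simp only [hR, indicator_of_notMem h, norm_zero]
      positivity
  have hRle1 (t : ℝ) (ht : 0 < t) : ‖R t‖ ≤ D := by
    by_cases h : t ∈ Ioc (0 : ℝ) 1
    · refine (hRle t ht).trans ?_
      exact mul_le_of_le_one_right hD0 (Real.rpow_le_one ht.le h.2 hδ.le)
    · simpa [hR, h] using hD0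
  have hRtop (t : ℝ) (ht : 1 < t) : R t = 0 := by
    simp [hR, ht]
  have hRint : LocallyIntegrableOn R (Ioi 0) := by
    have h : IntegrableOn (indicator (Ioc (0 : ℝ) 1) fun _ => D) (Ioi 0) := by
      refine Integrable.integrableOn ?_
      rw [integrable_indicator_iff measurableSet_Ioc]
      exact integrableOn_const (by simp)
    refine IntegrableOn.locallyIntegrableOn (Integrable.mono' h hRm.aestronglyMeasurable ?_)
    filter_upwards [ae_restrict_mem measurableSet_Ioi] with t ht
    by_cases h : t ∈ Ioc (0 : ℝ) 1
    · rw [indicator_of_mem h]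
      exact hRle1 t ht
    · simp [hR, h]
  have hRO (b : ℝ) : R =O[atTop] fun t => t ^ (-b) := by
    refine Asymptotics.IsBigO.of_bound 0 ?_
    filter_upwards [eventually_gt_atTop 1] with t ht
    simp [hRtop t ht]
  have hRO0 : R =O[𝓝[>] 0] fun t => t ^ (-(0 : ℝ)) := by
    refine Asymptotics.IsBigO.of_bound D ?_
    filter_upwards [self_mem_nhdsWithin] with t ht
    simpa using hRle1 t ht
  refine ⟨mellin R, fun s hs => ?_, ⟨∫ t in Ioi (0 : ℝ), indicator (Ioc (0 : ℝ) 1)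
    (fun t => D * t ^ (δ - 1)) t, fun s hs => ?_⟩, fun s hs => ?_⟩
  · exact (mellin_differentiableAt_of_isBigO_rpow hRint (hRO (s.re + 1)) (by linarith) hRO0
      hs).differentiableWithinAt
  · refine norm_integral_le_of_norm_le ?_ ?_
    · refine Integrable.integrableOn ?_
      rw [integrable_indicator_iff measurableSet_Ioc]
      refine Integrable.const_mul ?_ D
      have := (intervalIntegral.intervalIntegrable_rpow' (a := 0) (b := 1) (r := δ - 1)
        (by linarith))
      rwa [intervalIntegrable_iff_integrableOn_Ioc_of_le zero_le_one] at this
    · filter_upwards [ae_restrict_mem measurableSet_Ioi] with t ht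
      by_cases h : t ∈ Ioc (0 : ℝ) 1
      · rw [indicator_of_mem h, norm_smul, Complex.norm_cpow_eq_rpow_re_of_pos ht]
        have h1 := hRle t ht
        calc _ ≤ t ^ (s - 1).re * (D * t ^ δ) := by
              have : 0 < t := ht
              gcongr
          _ = t ^ s.re * (D * t ^ (δ - 1)) := by
              rw [Complex.sub_re, Complex.one_re, Real.rpow_sub_one (ne_of_gt ht),
                Real.rpow_sub_one (ne_of_gt ht)]
              ring
          _ ≤ _ := by
              have h2 := Real.rpow_pos_of_pos ht (δ - 1)
              exact mul_le_of_le_one_left (by positivity)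
                (Real.rpow_le_one (le_of_lt ht) h.2 (le_of_lt hs))
      · simp [hR, h]
  · have h1 := (hasSum_mellin_comp_mul (f := fun t => (g t : ℂ)) hNpos (hsum s.re hs) (by fun_prop)
      ha (fun y hy => hga y (by simpa using hy))).tsum_eq
    rw [tsum_mul_right, mul_comm] at h1
    rw [h1]
    have h2 : MellinConvergent R s :=
      mellinConvergent_of_isBigO_rpow hRint (hRO (s.re + 1)) (by linarith) hRO0 (by linarith)
    have h3 := hasMellin_cpow_Ioc (s := s) (-1 : ℂ) (by simpa using hs)
    have h4 := (h3.1.const_smul (c : ℂ))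
    have h5 := (hasMellin_add h2 h4).2
    rw [mellin_const_smul, h3.2] at h5
    rw [div_eq_mul_one_div, sub_eq_add_neg, ← smul_eq_mul, ← h5]
    refine setIntegral_congr_fun measurableSet_Ioi fun t ht => ?_
    simp only [← Complex.ofReal_tsum]
    congr 1
    by_cases h : t ∈ Ioc (0 : ℝ) 1
    · simp [hR, h, hG, Complex.cpow_neg_one, div_eq_mul_inv]
    · have : 1 < t := by
        by_contra h'
        exact h ⟨ht, not_lt.1 h'⟩
      have h6 : ∑' i, g (t * N i) = 0 := hG1 t this
      simp [hR, h, h6]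

end Mellin

namespace NumberField

open Module _root_.Ideal
open scoped nonZeroDivisors

lemma LSeriesSummable_card_absNorm {s : ℂ} (hs : 1 < s.re) :
    LSeriesSummable (fun n => (Nat.card {I : Ideal (𝓞 K) // absNorm I = n} : ℂ)) s := by
  have h : Tendsto (fun n : ℕ => (∑ k ∈ Finset.Icc 1 n,
      (Nat.card {I : Ideal (𝓞 K) // absNorm I = k} : ℝ)) / n) atTop
      (𝓝 (dedekindZeta_residue K)) := by
    refine ((Ideal.tendsto_norm_le_div_atTop₀ K).comp tendsto_natCast_atTop_atTop).congr fun n => ?_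
    simp only [Function.comp_apply, Nat.cast_le, ← Nat.cast_sum]
    congr
    rw [← add_left_inj 1, ← card_norm_le_eq_card_norm_le_add_one,
      show Finset.Icc 1 n = Finset.Ioc 0 n from Finset.Icc_succ_left_eq_Ioc _ _,
      show 1 = Nat.card {I : Ideal (𝓞 K) // absNorm I = 0} by simp [Ideal.absNorm_eq_zero_iff],
      Finset.sum_Ioc_add_eq_sum_Icc (n.zero_le),
      ← Finset.card_preimage_eq_sum_card_image_eq (fun k _ => finite_setOfPred_absNorm_eq k)]
    simp [Set.coe_eq_subtype]
  refine LSeriesSummable_of_sum_norm_bigO (r := 1) ?_ zero_le_one hs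
  simp only [Complex.norm_natCast, Real.rpow_one]
  refine Asymptotics.isBigO_of_div_tendsto_nhds ?_ _ h
  filter_upwards [eventually_ne_atTop 0] with n hn h0
  exact absurd (Nat.cast_eq_zero.1 h0) hn

lemma tsum_absNorm_fiber (n : ℕ) {α : Type*} [NormedField α] [CharZero α] (c : ℕ → α)
    (hc : c 0 = 0) :
    ∑' I : {I : (Ideal (𝓞 K))⁰ // absNorm (I : Ideal (𝓞 K)) = n},
      c (absNorm (I.1 : Ideal (𝓞 K))) = Nat.card {I : Ideal (𝓞 K) // absNorm I = n} * c n := by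
  rcases eq_or_ne n 0 with rfl | hn
  · have : IsEmpty {I : (Ideal (𝓞 K))⁰ // absNorm (I : Ideal (𝓞 K)) = 0} :=
      ⟨fun I => Ideal.absNorm_ne_zero_of_nonZeroDivisors I.1 I.2⟩
    rw [tsum_empty, hc, mul_zero]
  · have e : {I : (Ideal (𝓞 K))⁰ // absNorm (I : Ideal (𝓞 K)) = n} ≃
        {I : Ideal (𝓞 K) // absNorm I = n} :=
      { toFun := fun I => ⟨I.1, I.2⟩
        invFun := fun I => ⟨⟨I.1, mem_nonZeroDivisors_of_ne_zero (by
          rintro h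
          apply hn
          rw [← I.2, h]
          simp)⟩, I.2⟩
        left_inv := fun I => rfl
        right_inv := fun I => rfl }
    have : Finite {I : Ideal (𝓞 K) // absNorm I = n} := finite_setOfPred_absNorm_eq n
    have : Finite {I : (Ideal (𝓞 K))⁰ // absNorm (I : Ideal (𝓞 K)) = n} := .of_equiv _ e.symm
    have := Fintype.ofFinite {I : (Ideal (𝓞 K))⁰ // absNorm (I : Ideal (𝓞 K)) = n}
    rw [tsum_fintype, Finset.sum_congr rfl fun I _ => congrArg c I.2, Finset.sum_const,
      nsmul_eq_mul, Finset.card_univ, ← Nat.card_eq_fintype_card, Nat.card_congr e]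

lemma summable_absNorm_rpow {σ : ℝ} (hσ : 1 < σ) :
    Summable fun I : (Ideal (𝓞 K))⁰ => (absNorm (I : Ideal (𝓞 K)) : ℝ) ^ (-σ) := by
  let e := Equiv.sigmaFiberEquiv fun I : (Ideal (𝓞 K))⁰ => absNorm (I : Ideal (𝓞 K))
  rw [← e.summable_iff]
  refine (summable_sigma_of_nonneg fun I => Real.rpow_nonneg (Nat.cast_nonneg _) _).2
    ⟨fun n => ?_, ?_⟩
  · have : Finite {I : (Ideal (𝓞 K))⁰ // absNorm (I : Ideal (𝓞 K)) = n} :=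
      ((finite_setOfPred_absNorm_eq n).preimage
        (f := fun I : (Ideal (𝓞 K))⁰ => (I : Ideal (𝓞 K))) Subtype.val_injective.injOn)
    exact Summable.of_finite
  · have h := (LSeriesSummable_card_absNorm K (s := (σ : ℂ)) hσ).norm
    refine h.congr fun n => ?_
    refine Eq.trans ?_ (tsum_absNorm_fiber K n (fun n => (n : ℝ) ^ (-σ))
      (by simp [Real.zero_rpow (by linarith : -σ ≠ 0)])).symm
    rw [LSeries.norm_term_eq]
    split_ifs with hn
    · rw [hn, Nat.cast_zero, Real.zero_rpow (by linarith : -σ ≠ 0), mul_zero]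
    · simp [Real.rpow_neg, div_eq_mul_inv]

lemma tsum_absNorm_cpow_eq_dedekindZeta {s : ℂ} (hs : 1 < s.re) :
    ∑' I : (Ideal (𝓞 K))⁰, (absNorm (I : Ideal (𝓞 K)) : ℂ) ^ (-s) = dedekindZeta K s := by
  let e := Equiv.sigmaFiberEquiv fun I : (Ideal (𝓞 K))⁰ => absNorm (I : Ideal (𝓞 K))
  have hs0 : -s ≠ 0 := neg_ne_zero.2 (ne_zero_of_re_pos (one_pos.trans hs))
  have hsum : Summable fun I : (Ideal (𝓞 K))⁰ => (absNorm (I : Ideal (𝓞 K)) : ℂ) ^ (-s) := by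
    refine .of_norm ((summable_absNorm_rpow K hs).congr fun I => ?_)
    rw [norm_natCast_cpow_of_pos (Nat.pos_of_ne_zero
      (Ideal.absNorm_ne_zero_of_nonZeroDivisors I)), neg_re]
  have h1 := e.tsum_eq fun I : (Ideal (𝓞 K))⁰ => (absNorm (I : Ideal (𝓞 K)) : ℂ) ^ (-s)
  have h2 := Summable.tsum_sigma (e.summable_iff.2 hsum)
  rw [← h1]
  refine h2.trans (tsum_congr fun n => ?_)
  refine (tsum_absNorm_fiber K n (fun n => (n : ℂ) ^ (-s)) (by simp [hs0])).trans ?_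
  rw [LSeries.term_of_ne_zero' (neg_ne_zero.1 hs0), Complex.cpow_neg, div_eq_mul_inv]

end NumberField

lemma exists_smooth_bump : ∃ g : ℝ → ℝ, ContDiff ℝ (⊤ : ℕ∞) g ∧ (∀ y, 0 ≤ g y) ∧
    (∀ y, g y ≠ 0 → 1 / 2 ≤ y ∧ y ≤ 1) ∧ mellin (fun t => (g t : ℂ)) 1 ≠ 0 := by
  let φ : ContDiffBump (3 / 4 : ℝ) := ⟨1 / 8, 1 / 4, by norm_num, by norm_num⟩
  have hφ (y : ℝ) (hy : φ y ≠ 0) : 1 / 2 ≤ y ∧ y ≤ 1 := by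
    have h : y ∈ Function.support φ := hy
    rw [φ.support_eq, Real.ball_eq_Ioo] at h
    obtain ⟨h1, h2⟩ := h
    simp only [φ] at h1 h2
    constructor <;> linarith
  refine ⟨φ, φ.contDiff, fun y => φ.nonneg, hφ, ?_⟩
  have h : mellin (fun t => (φ t : ℂ)) 1 = ((∫ t, φ t : ℝ) : ℂ) := by
    simp only [mellin, sub_self, Complex.cpow_zero, one_smul]
    rw [integral_complex_ofReal]
    congr 1
    refine setIntegral_eq_integral_of_forall_compl_eq_zero fun t ht => ?_
    by_contra h
    exact ht (lt_of_lt_of_le (by norm_num) (hφ t h).1)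
  rw [h, Complex.ofReal_ne_zero]
  refine (φ.continuous.integral_pos_of_hasCompactSupport_nonneg_nonzero φ.hasCompactSupport
    (fun y => φ.nonneg) (x := 3 / 4) ?_).ne'
  rw [φ.one_of_mem_closedBall (Metric.mem_closedBall_self φ.rIn_pos.le)]
  exact one_ne_zero

lemma isPreconnected_halfPlane_diff_one : IsPreconnected ({s : ℂ | 0 < s.re} \ {1}) := by
  have h1 : IsPreconnected ({s : ℂ | 0 < s.re} ∩ {s | 0 < s.im}) :=
    ((convex_halfSpace_re_gt 0).inter (convex_halfSpace_im_gt 0)).isPreconnected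
  have h2 : IsPreconnected {s : ℂ | 1 < s.re} := (convex_halfSpace_re_gt 1).isPreconnected
  have h3 : IsPreconnected ({s : ℂ | 0 < s.re} ∩ {s | s.im < 0}) :=
    ((convex_halfSpace_re_gt 0).inter (convex_halfSpace_im_lt 0)).isPreconnected
  have h4 : IsPreconnected ({s : ℂ | 0 < s.re} ∩ {s | s.re < 1}) :=
    ((convex_halfSpace_re_gt 0).inter (convex_halfSpace_re_lt 1)).isPreconnected
  have h12 := h1.union ⟨2, 1⟩ (by simp) (by simp) h2
  have h123 := h12.union ⟨2, -1⟩ (by simp) (by simp) h3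
  have h := h123.union ⟨1 / 2, 1⟩ (by simp) (by norm_num) h4
  convert h using 1
  ext s
  simp only [Set.mem_sdiff, Set.mem_singleton_iff, Set.mem_union, Set.mem_inter_iff,
    Set.mem_ofPred_eq]
  constructor
  · rintro ⟨hs, hs1⟩
    rcases lt_trichotomy s.im 0 with h | h | h
    · tauto
    · rcases lt_trichotomy s.re 1 with h' | h' | h'
      · tauto
      · exact absurd (Complex.ext h' h) hs1
      · tauto
    · tauto
  · rintro (((h | h) | h) | h)
    · refine ⟨h.1, ?_⟩
      rintro rfl
      simp at h
    · refine ⟨by linarith, ?_⟩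
      rintro rfl
      simp at h
    · refine ⟨h.1, ?_⟩
      rintro rfl
      simp at h
    · refine ⟨h.1, ?_⟩
      rintro rfl
      simp at h

/-- The function `s ↦ ((s - 1) F(s) + c) / (s + 1)` is bounded on the right half plane
and vanishes at the zeros of `Z`, so Blaschke's condition applies to those. -/
lemma CriticalZeroEnumFor.summable_inv_sq {Z m F : ℂ → ℂ} {c : ℂ} {B : ℝ} {sν : ℕ → ℂ}
    (henum : CriticalZeroEnumFor Z sν) (hZ : ∀ s : ℂ, s ≠ 1 → DifferentiableAt ℂ Z s)
    (hm : Differentiable ℂ m) (hF : DifferentiableOn ℂ F {s | 0 < s.re})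
    (hB : ∀ s, 0 < s.re → ‖F s‖ ≤ B) (hc : c ≠ 0)
    (heq : ∀ s : ℂ, 0 < s.re → s ≠ 1 → (s - 1) * (m s * Z s) = (s - 1) * F s + c) :
    Summable fun ν => (‖sν ν‖ ^ 2)⁻¹ := by
  have hopen : IsOpen {s : ℂ | 0 < s.re} := isOpen_lt continuous_const Complex.continuous_re
  have hre (ν) : 0 < (sν ν).re := by
    rw [(henum.1 ν).1]
    norm_num
  have hplus (s : ℂ) (hs : 0 < s.re) : 1 ≤ ‖s + 1‖ := by
    refine le_trans ?_ (Complex.re_le_norm _)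
    simpa using hs.le
  have hplus0 (s : ℂ) (hs : 0 < s.re) : s + 1 ≠ 0 :=
    norm_pos_iff.1 (one_pos.trans_le (hplus s hs))
  set H : ℂ → ℂ := fun s => ((s - 1) * F s + c) / (s + 1) with hH
  have hHd : DifferentiableOn ℂ H {s | 0 < s.re} := by
    refine DifferentiableOn.div ?_ (by fun_prop) hplus0
    fun_prop
  have hHB (s : ℂ) (hs : 0 < s.re) : ‖H s‖ ≤ B + ‖c‖ := by
    have h1 : ‖s - 1‖ ≤ ‖s + 1‖ := by
      refine (sq_le_sq₀ (norm_nonneg _) (norm_nonneg _)).1 ?_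
      rw [← Complex.normSq_eq_norm_sq, ← Complex.normSq_eq_norm_sq, Complex.normSq_apply,
        Complex.normSq_apply]
      simp only [Complex.sub_re, Complex.add_re, Complex.sub_im, Complex.add_im, Complex.one_re,
        Complex.one_im]
      nlinarith
    have h2 := hplus s hs
    have h3 := hB s hs
    rw [hH, norm_div, div_le_iff₀ (by linarith)]
    calc _ ≤ ‖s - 1‖ * ‖F s‖ + ‖c‖ := (norm_add_le _ _).trans_eq (by rw [norm_mul])
      _ ≤ ‖s + 1‖ * B + ‖c‖ * ‖s + 1‖ := by
        gcongr
        exact le_mul_of_one_le_right (norm_nonneg c) h2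
      _ = _ := by ring
  have hord (z : ℂ) (hz : 0 < z.re) (T : Finset ℕ) (hT : ∀ i ∈ T, sν i = z) :
      (T.card : ℕ∞) ≤ analyticOrderAt H z := by
    rcases T.eq_empty_or_nonempty with rfl | ⟨i, hi⟩
    · simp
    obtain ⟨h1, h2, h3⟩ := henum.1 i
    rw [hT i hi] at h1 h2 h3
    have hz1 : z ≠ 1 := by
      rintro rfl
      simp at h2
    have hZan : AnalyticAt ℂ Z z := by
      refine DifferentiableOn.analyticAt (s := {1}ᶜ) (fun w hw => ?_)
        (isOpen_compl_singleton.mem_nhds hz1)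
      exact (hZ w hw).differentiableWithinAt
    obtain ⟨g, hg, hg0, hgZ⟩ := henum.2 z h1 h2 h3
    set k := Nat.card {ν : ℕ // sν ν = z} with hk
    have hgZ' : ∀ᶠ w in 𝓝 z, Z w = (w - z) ^ k * g w :=
      (hZan.continuousAt.eventuallyEq_nhds_iff_eventuallyEq_nhdsNE
        (((by fun_prop : ContinuousAt (fun w => (w - z) ^ k) z)).mul hg.continuousAt)).1 hgZ
    have hk0 : k ≠ 0 := by
      intro h0
      have := hgZ'.self_of_nhds
      rw [h3, h0, pow_zero, one_mul] at this
      exact hg0 this.symm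
    have : Finite {ν : ℕ // sν ν = z} := Nat.finite_of_card_ne_zero hk0
    have hTk : T.card ≤ k := by
      have hsub : (T : Set ℕ) ⊆ {ν | sν ν = z} := fun i hi => hT i hi
      have hle := Set.ncard_le_ncard hsub (Set.finite_coe_iff.1 this)
      rwa [Set.ncard_coe_finset] at hle
    refine le_trans (Nat.cast_le.2 hTk) ((natCast_le_analyticOrderAt
      (hHd.analyticAt (hopen.mem_nhds hz))).2
      ⟨fun w => g w * ((w - 1) * m w / (w + 1)), ?_, ?_⟩)
    · have hman : AnalyticAt ℂ m z := hm.analyticAt z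
      exact hg.mul ((((analyticAt_id).sub analyticAt_const).mul hman).div
        ((analyticAt_id).add analyticAt_const) (hplus0 z hz))
    · filter_upwards [hgZ', hopen.mem_nhds hz, isOpen_compl_singleton.mem_nhds hz1]
        with w hw hw0 hw1
      simp only [hH]
      rw [← heq w hw0 hw1, hw, smul_eq_mul]
      ring
  have hsum := summable_blaschke sν hre hHd hHB hord (s := 1) (by simp) (by
    simpa [hH] using hc)
  refine Summable.of_nonneg_of_le (fun ν => by positivity) (fun ν => ?_) (hsum.mul_left (9 / 2))
  have h1 := (henum.1 ν).1
  have h2 : 1 / 2 ≤ ‖sν ν‖ := h1 ▸ Complex.re_le_norm _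
  have h3 : ‖1 + starRingEnd ℂ (sν ν)‖ ≤ 3 * ‖sν ν‖ := by
    refine (norm_add_le _ _).trans ?_
    rw [norm_one, Complex.norm_conj]
    linarith
  have h4 : 0 < ‖1 + starRingEnd ℂ (sν ν)‖ := by
    refine lt_of_lt_of_le ?_ (Complex.re_le_norm _)
    simp [h1]
    norm_num
  rw [h1, Complex.one_re, inv_eq_one_div, div_le_iff₀ (by positivity)]
  have h5 : ‖1 + starRingEnd ℂ (sν ν)‖ ^ 2 ≤ (3 * ‖sν ν‖) ^ 2 := by gcongr
  rw [show 9 / 2 * (4 * 1 * (1 / 2) / ‖1 + starRingEnd ℂ (sν ν)‖ ^ 2) * ‖sν ν‖ ^ 2 =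
    (3 * ‖sν ν‖) ^ 2 / ‖1 + starRingEnd ℂ (sν ν)‖ ^ 2 by ring, le_div_iff₀ (by positivity), one_mul]
  exact h5

namespace NumberField

open Module
open scoped nonZeroDivisors

/-- Meromorphic continuation of the Dedekind zeta function to the right half plane, up to an
entire factor `m`, with a bound for the regular part. -/
theorem exists_mul_eq_of_isDedekindSeries {Z : ℂ → ℂ} (hser : IsDedekindSeries K Z)
    (hZ : ∀ s : ℂ, s ≠ 1 → DifferentiableAt ℂ Z s) :
    ∃ (m F : ℂ → ℂ) (c : ℂ) (B : ℝ), Differentiable ℂ m ∧ m 1 ≠ 0 ∧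
      DifferentiableOn ℂ F {s | 0 < s.re} ∧ (∀ s, 0 < s.re → ‖F s‖ ≤ B) ∧
      ∀ s : ℂ, 0 < s.re → s ≠ 1 → (s - 1) * (m s * Z s) = (s - 1) * F s + c := by
  obtain ⟨g, hg, hg0, hga, hg1⟩ := exists_smooth_bump
  have hgc : Continuous g := hg.continuous
  obtain ⟨c, D, hcD⟩ := exists_abs_tsum_ideal_sub_le K hg hg0 one_half_pos hga
  obtain ⟨F, hF, ⟨B, hB⟩, hFeq⟩ := exists_mellin_mul_tsum_eq
    (N := fun I : (Ideal (𝓞 K))⁰ => (Ideal.absNorm (I : Ideal (𝓞 K)) : ℝ))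
    (fun I => Nat.one_le_cast.2 (Nat.one_le_iff_ne_zero.2
      (Ideal.absNorm_ne_zero_of_nonZeroDivisors I)))
    (fun σ hσ => summable_absNorm_rpow K hσ) hgc hg0 one_half_pos hga
    (inv_pos.2 (Nat.cast_pos.2 finrank_pos)) hcD
  have hm : Differentiable ℂ (mellin fun t => (g t : ℂ)) :=
    differentiable_mellin (by fun_prop) one_half_pos fun y hy => hga y (by simpa using hy)
  refine ⟨mellin fun t => (g t : ℂ), F, c, B, hm, hg1, hF, hB, fun s hs hs1 => ?_⟩
  have hU : IsOpen ({s : ℂ | 0 < s.re} \ {1}) :=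
    (isOpen_lt continuous_const Complex.continuous_re).sdiff isClosed_singleton
  have hZU : DifferentiableOn ℂ Z ({s : ℂ | 0 < s.re} \ {1}) := fun s hs =>
    (hZ s hs.2).differentiableWithinAt
  have hFU : DifferentiableOn ℂ F ({s : ℂ | 0 < s.re} \ {1}) := hF.mono Set.sdiff_subset
  have hmU := hm.differentiableOn (s := {s : ℂ | 0 < s.re} \ {1})
  refine AnalyticOnNhd.eqOn_of_preconnected_of_eventuallyEq
    (f := fun s => (s - 1) * (mellin (fun t => (g t : ℂ)) s * Z s))
    (g := fun s => (s - 1) * F s + c) (z₀ := 2)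
    (DifferentiableOn.analyticOnNhd (by fun_prop) hU)
    (DifferentiableOn.analyticOnNhd (by fun_prop) hU)
    isPreconnected_halfPlane_diff_one ⟨by simp, by norm_num⟩ ?_ ⟨hs, hs1⟩
  have h2 : {s : ℂ | 1 < s.re} ∈ 𝓝 (2 : ℂ) :=
    (isOpen_lt continuous_const Complex.continuous_re).mem_nhds (by simp)
  filter_upwards [h2] with w hw
  have hw1 : w - 1 ≠ 0 := by
    intro h
    rw [sub_eq_zero] at h
    simp [h] at hw
  have hsum : Z w = ∑' I : (Ideal (𝓞 K))⁰, (Ideal.absNorm (I : Ideal (𝓞 K)) : ℂ) ^ (-w) := by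
    rw [hser w hw]
    exact (Equiv.subtypeEquivRight fun I => mem_nonZeroDivisors_iff_ne_zero).symm.tsum_eq
      fun I : (Ideal (𝓞 K))⁰ => (Ideal.absNorm (I : Ideal (𝓞 K)) : ℂ) ^ (-w)
  have h3 := hFeq w hw
  simp only [Complex.ofReal_natCast] at h3
  rw [hsum, h3, mul_add, mul_div_cancel₀ _ hw1]

lemma tendsto_sub_one_mul_of_isDedekindSeries {Z : ℂ → ℂ} (hser : IsDedekindSeries K Z) :
    Tendsto (fun s : ℝ => ((s : ℂ) - 1) * Z s) (𝓝[>] 1) (𝓝 (dedekindResidue K : ℂ)) := by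
  have hres : dedekindZeta_residue K = dedekindResidue K := by
    rw [dedekindZeta_residue_def, dedekindResidue, absDisc]
    ring
  rw [← hres]
  refine (tendsto_sub_one_mul_dedekindZeta_nhdsGT K).congr' ?_
  filter_upwards [self_mem_nhdsWithin] with s hs
  have hs' : 1 < (s : ℂ).re := hs
  rw [hser s hs', ← tsum_absNorm_cpow_eq_dedekindZeta K hs']
  congr 1
  exact ((Equiv.subtypeEquivRight fun I => mem_nonZeroDivisors_iff_ne_zero).symm.tsum_eq
    fun I : (Ideal (𝓞 K))⁰ => (Ideal.absNorm (I : Ideal (𝓞 K)) : ℂ) ^ (-(s : ℂ))).symm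

lemma dedekindResidue_ne_zero : (dedekindResidue K : ℂ) ≠ 0 := by
  have h : 0 < absDisc K := abs_pos.2 (Int.cast_ne_zero.2 (discr_ne_zero K))
  have h1 := Units.regulator_pos K
  have h2 := classNumber_pos K
  have h3 := Units.torsionOrder_pos K
  rw [Complex.ofReal_ne_zero, dedekindResidue]
  positivity

end NumberField

/-- `η_κ` has a simple pole at `s = 1` with
`lim_{s→1} (s-1) η_κ(s) = 2^{r₁} (2π)^{r₂} c_κ R_κ / (w_κ √|D_κ|)`; in particular, by the
analytic class number formula, `η_κ` and `ζ_κ` have the same residue at `s = 1`. -/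
theorem etaKfun_residue (zK : ℂ → ℂ) (sν : ℕ → ℂ)
    (hser : IsDedekindSeries K zK)
    (hdiff : ∀ s : ℂ, s ≠ 1 → DifferentiableAt ℂ zK s)
    (henum : CriticalZeroEnumFor zK sν) :
    Tendsto (fun s : ℂ => (s - 1) * etaKfun K sν s) (𝓝[≠] 1)
      (𝓝 (dedekindResidue K : ℂ)) ∧
    Tendsto (fun s : ℂ => (s - 1) * zK s) (𝓝[≠] 1) (𝓝 (dedekindResidue K : ℂ)) := by
  obtain ⟨m, F, c, B, hm, hm1, hF, hB, heq⟩ := exists_mul_eq_of_isDedekindSeries K hser hdiff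
  have hpos : {s : ℂ | 0 < s.re} ∈ 𝓝 (1 : ℂ) :=
    (isOpen_lt continuous_const Complex.continuous_re).mem_nhds (by simp)
  have hF1 : ContinuousAt F 1 := (hF.differentiableAt hpos).continuousAt
  have hlim : Tendsto (fun s => ((s - 1) * F s + c) / m s) (𝓝 1) (𝓝 (c / m 1)) := by
    have h : ContinuousAt (fun s => ((s - 1) * F s + c) / m s) 1 :=
      (((continuousAt_id.sub continuousAt_const).mul hF1).add continuousAt_const).div
        hm.continuous.continuousAt hm1
    simpa [ContinuousAt] using h
  have hlim' : Tendsto (fun s => (s - 1) * zK s) (𝓝[≠] 1) (𝓝 (c / m 1)) := by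
    refine (hlim.mono_left nhdsWithin_le_nhds).congr' ?_
    filter_upwards [self_mem_nhdsWithin, nhdsWithin_le_nhds hpos,
      nhdsWithin_le_nhds (hm.continuous.continuousAt.eventually_ne hm1)] with s hs1 hs0 hms
    rw [← heq s hs0 hs1, div_eq_iff hms]
    ring
  have hreal : Tendsto (fun s : ℝ => (s : ℂ)) (𝓝[>] 1) (𝓝[≠] 1) := by
    refine tendsto_nhdsWithin_iff.2 ⟨?_, ?_⟩
    · exact (Complex.continuous_ofReal.tendsto' 1 1 (by simp)).mono_left nhdsWithin_le_nhds
    · filter_upwards [self_mem_nhdsWithin] with s hs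
      have hs' : (1 : ℝ) < s := hs
      simpa using hs'.ne'
  have hc : c / m 1 = dedekindResidue K :=
    tendsto_nhds_unique (hlim'.comp hreal) (tendsto_sub_one_mul_of_isDedekindSeries K hser)
  rw [hc] at hlim'
  refine ⟨tendsto_sub_one_mul_etaKfun K (henum.summable_inv_sq hdiff hm hF hB ?_ heq), hlim'⟩
  rintro rfl
  exact dedekindResidue_ne_zero K (by rw [← hc, zero_div])
end
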